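/- arXiv:2201.11071 — 5 statements merged into one kernel-verified Lean document; each statement's English description precedes it below -/
import Mathlib

section
/- A squarefree integer α > 0 is a congruent number if and only if there exist rational numbers x and y with y ≠ 0 such that α·y² = x³ − x. -/
/-- A positive integer `α` is a *congruent number* if it is the area of a right triangle
with rational sides: there are positive rationals `a`, `b`, `c` with `a² + b² = c²`
and `α = a * b / 2`. -/
def IsCongruentNumber (α : ℕ) : Prop :=
  ∃ a b c : ℚ, 0 < a ∧ 0 < b ∧ 0 < c ∧ a ^ 2 + b ^ 2 = c ^ 2 ∧ (α : ℚ) = a * b / 2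

theorem congruent_iff_exists_point (α : ℕ) (hα : 0 < α) (hsf : Squarefree α) :
    IsCongruentNumber α ↔
      ∃ x y : ℚ, y ≠ 0 ∧ (α : ℚ) * y ^ 2 = x ^ 3 - x := by
  constructor
  · rintro ⟨a, b, c, ha, hb, hc, h, e⟩
    refine ⟨(a + c) / b, 2 * (a + c) / b ^ 2, by positivity, ?_⟩
    rw [e]
    field_simp
    have h2 : b ^ 2 = c ^ 2 - a ^ 2 := by linarith
    rw [h2]
    ring
  · rintro ⟨x, y, hy, h⟩
    have hα' : (0 : ℚ) < α := by exact_mod_cast hα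
    have hp : 0 < x ^ 3 - x := by rw [← h]; positivity
    have hx : x ≠ 0 := by rintro rfl; norm_num at hp
    have hx1 : x ^ 2 - 1 ≠ 0 := by
      intro h0
      have h1 : x ^ 3 - x = x * (x ^ 2 - 1) := by ring
      rw [h1, h0] at hp
      norm_num at hp
    refine ⟨|(x ^ 2 - 1) / y|, |2 * x / y|, |(x ^ 2 + 1) / y|, by positivity, by positivity,
      by positivity, ?_, ?_⟩
    · rw [sq_abs, sq_abs, sq_abs]
      field_simp
      ring
    · have h3 : (x ^ 2 - 1) / y * (2 * x / y) = 2 * α := by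
        field_simp
        linarith
      rw [← abs_mul, h3, abs_of_pos (by positivity)]
      ring
end

section
/- A squarefree integer α > 0 is a congruent number if and only if the set of rational points (x, y) ∈ ℚ × ℚ satisfying α·y² = x³ − x is infinite. -/
/-- Duplication on the curve `α y² = x³ - x`. -/
theorem double_point (α x y : ℚ) (hα : α ≠ 0) (hy : y ≠ 0) (h : α * y ^ 2 = x ^ 3 - x) :
    α * ((x ^ 2 + 1) * (x ^ 2 + 2 * x - 1) * (x ^ 2 - 2 * x - 1) / (8 * α ^ 2 * y ^ 3)) ^ 2 =
      ((x ^ 2 + 1) ^ 2 / (4 * (x ^ 3 - x))) ^ 3 - (x ^ 2 + 1) ^ 2 / (4 * (x ^ 3 - x)) := by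
  have hd : x ^ 3 - x ≠ 0 := by rw [← h]; positivity
  have h1 : α * ((x ^ 2 + 1) * (x ^ 2 + 2 * x - 1) * (x ^ 2 - 2 * x - 1)
      / (8 * α ^ 2 * y ^ 3)) ^ 2 =
      ((x ^ 2 + 1) * (x ^ 2 + 2 * x - 1) * (x ^ 2 - 2 * x - 1)) ^ 2 / (64 * (α * y ^ 2) ^ 3) := by
    field_simp
    norm_num
  rw [h1, h, eq_sub_iff_add_eq]
  generalize hD : x ^ 3 - x = D at *
  field_simp
  rw [← hD]
  ring

/-- The curve has a point whose abscissa is (odd)/(nonzero multiple of `2 ^ n`). -/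
def HasPt (α : ℚ) (n : ℕ) : Prop :=
  ∃ (x y : ℚ) (p q : ℤ), α * y ^ 2 = x ^ 3 - x ∧ y ≠ 0 ∧ Odd p ∧ q ≠ 0 ∧ (2 : ℤ) ^ n ∣ q ∧ x * q = p

theorem y_ne_zero_of (α x y : ℚ) (p q : ℤ) (h : α * y ^ 2 = x ^ 3 - x) (hp : Odd p)
    (hq0 : q ≠ 0) (hq : Even q) (hx : x * q = p) : y ≠ 0 := by
  rintro rfl
  have h2 : x * (x - 1) * (x + 1) = 0 := by linear_combination -h
  rcases mul_eq_zero.1 h2 with h3 | h3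
  · rcases mul_eq_zero.1 h3 with h4 | h4
    · rw [h4, zero_mul] at hx
      have : p = 0 := by exact_mod_cast hx.symm
      subst this
      simp at hp
    · have : (p : ℚ) = q := by rw [← hx]; linear_combination (q : ℚ) * h4
      have : p = q := by exact_mod_cast this
      subst this
      exact (Int.not_even_iff_odd.2 hp) hq
  · have : (p : ℚ) = -q := by rw [← hx]; linear_combination (q : ℚ) * h3
    have : p = -q := by exact_mod_cast this
    subst this
    exact (Int.not_even_iff_odd.2 hp) hq.neg

theorem double_frac (α x y : ℚ) (p q : ℤ) (hα : α ≠ 0) (h : α * y ^ 2 = x ^ 3 - x) (hy : y ≠ 0)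
    (hq0 : q ≠ 0) (hx : x * q = p) :
    4 * p * q * (p ^ 2 - q ^ 2) ≠ 0 ∧
    (x ^ 2 + 1) ^ 2 / (4 * (x ^ 3 - x)) * ((4 * p * q * (p ^ 2 - q ^ 2) : ℤ) : ℚ) =
      (((p ^ 2 + q ^ 2) ^ 2 : ℤ) : ℚ) := by
  have hd : x ^ 3 - x ≠ 0 := by rw [← h]; positivity
  have hq' : (q : ℚ) ≠ 0 := by exact_mod_cast hq0
  have e : ((4 * p * q * (p ^ 2 - q ^ 2) : ℤ) : ℚ) = 4 * (x ^ 3 - x) * q ^ 4 := by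
    push_cast; rw [← hx]; ring
  constructor
  · have : ((4 * p * q * (p ^ 2 - q ^ 2) : ℤ) : ℚ) ≠ 0 := by
      rw [e]; positivity
    exact_mod_cast this
  · rw [e]
    push_cast
    rw [← hx]
    generalize x ^ 3 - x = D at *
    field_simp
    try ring

theorem hasPt_step (α : ℚ) (hα : α ≠ 0) (n : ℕ) (hn : 0 < n) (H : HasPt α n) :
    HasPt α (n + 1) := by
  obtain ⟨x, y, p, q, h, hy, hp, hq0, hq, hx⟩ := H
  obtain ⟨h0, h1⟩ := double_frac α x y p q hα h hy hq0 hx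
  have hqe : Even q := even_iff_two_dvd.2 ((dvd_pow_self 2 hn.ne').trans hq)
  have hdv : (2 : ℤ) ^ (n + 1) ∣ 4 * p * q * (p ^ 2 - q ^ 2) := by
    obtain ⟨k, rfl⟩ := hq
    exact ⟨2 * p * k * (p ^ 2 - (2 ^ n * k) ^ 2), by ring⟩
  have ho : Odd ((p ^ 2 + q ^ 2) ^ 2) :=
    ((hp.pow).add_even (hqe.pow_of_ne_zero two_ne_zero)).pow
  have hc := double_point α x y hα hy h
  refine ⟨_, _, _, _, hc, ?_, ho, h0, hdv, h1⟩
  exact y_ne_zero_of α _ _ _ _ hc ho h0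
    (even_iff_two_dvd.2 ((dvd_pow_self 2 n.succ_ne_zero).trans hdv)) h1

theorem hasPt_one (α : ℚ) (hα : α ≠ 0) (x y : ℚ) (h : α * y ^ 2 = x ^ 3 - x) (hy : y ≠ 0) :
    HasPt α 1 := by
  have hx : x * (x.den : ℤ) = x.num := by exact_mod_cast Rat.mul_den_eq_num x
  have hq0 : (x.den : ℤ) ≠ 0 := by exact_mod_cast x.den_nz
  have hcop : IsCoprime x.num (x.den : ℤ) := by
    rw [Int.isCoprime_iff_gcd_eq_one]; exact x.reduced
  generalize (x.den : ℤ) = q at *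
  generalize x.num = p at *
  obtain ⟨h0, h1⟩ := double_frac α x y p q hα h hy hq0 hx
  have hc := double_point α x y hα hy h
  have key : ∃ p' q' : ℤ, Odd p' ∧ q' ≠ 0 ∧ Even q' ∧
      (x ^ 2 + 1) ^ 2 / (4 * (x ^ 3 - x)) * q' = p' := by
    rcases Int.even_or_odd p with hp | hp <;> rcases Int.even_or_odd q with hq | hq
    · exfalso
      have := hcop.isUnit_of_dvd' (even_iff_two_dvd.1 hp) (even_iff_two_dvd.1 hq)
      rw [Int.isUnit_iff] at this
      omega
    · refine ⟨_, _, ?_, h0, ?_, h1⟩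
      · exact ((hp.pow_of_ne_zero two_ne_zero).add_odd hq.pow).pow
      · exact ⟨2 * p * q * (p ^ 2 - q ^ 2), by ring⟩
    · refine ⟨_, _, ?_, h0, ?_, h1⟩
      · exact (hp.pow.add_even (hq.pow_of_ne_zero two_ne_zero)).pow
      · exact ⟨2 * p * q * (p ^ 2 - q ^ 2), by ring⟩
    · obtain ⟨a, rfl⟩ := hp
      obtain ⟨b, rfl⟩ := hq
      refine ⟨(2 * (a ^ 2 + a + b ^ 2 + b) + 1) ^ 2,
        (2 * a + 1) * (2 * b + 1) * ((2 * a + 1) ^ 2 - (2 * b + 1) ^ 2), ?_, ?_, ?_, ?_⟩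
      · exact (odd_two_mul_add_one _).pow
      · intro h2
        apply h0
        linear_combination 4 * h2
      · exact ⟨(2 * a + 1) * (2 * b + 1) * (2 * (a ^ 2 + a - b ^ 2 - b)), by ring⟩
      · push_cast at h1 ⊢
        linear_combination h1 / 4
  obtain ⟨p', q', ho, hq', he, hx'⟩ := key
  refine ⟨_, _, p', q', hc, y_ne_zero_of α _ _ _ _ hc ho hq' he hx', ho, hq', ?_, hx'⟩
  rw [pow_one]; exact even_iff_two_dvd.1 he

theorem infinite_of_point (α : ℚ) (hα : α ≠ 0) (x y : ℚ) (h : α * y ^ 2 = x ^ 3 - x)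
    (hy : y ≠ 0) : {P : ℚ × ℚ | α * P.2 ^ 2 = P.1 ^ 3 - P.1}.Infinite := by
  intro hfin
  have hall : ∀ n : ℕ, HasPt α (n + 1) := by
    intro n
    induction n with
    | zero => exact hasPt_one α hα x y h hy
    | succ k ih => exact hasPt_step α hα _ k.succ_pos ih
  obtain ⟨N, hN⟩ := (hfin.image (fun P : ℚ × ℚ => P.1.den)).bddAbove
  obtain ⟨x, y, p, q, h, -, hp, hq0, hq, hx⟩ := hall N
  have hle : x.den ≤ N := hN ⟨(x, y), h, rfl⟩
  have e : x.num * q = p * x.den := by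
    have h1 : x * x.den = x.num := Rat.mul_den_eq_num x
    have : (x.num : ℚ) * q = p * x.den := by rw [← h1, ← hx]; ring
    exact_mod_cast this
  have hd : (2 : ℤ) ^ (N + 1) ∣ p * x.den := e ▸ hq.mul_left _
  have hc : IsCoprime ((2 : ℤ) ^ (N + 1)) p := by
    apply IsCoprime.pow_left
    obtain ⟨k, rfl⟩ := hp
    exact ⟨-k, 1, by ring⟩
  have hd2 : 2 ^ (N + 1) ∣ x.den := by exact_mod_cast hc.dvd_of_dvd_mul_left hd
  have h3 := Nat.le_of_dvd x.den_pos hd2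
  have h4 : N + 1 < 2 ^ (N + 1) := Nat.lt_two_pow_self
  omega

theorem congruent_iff_infinite_points (α : ℕ) (hα : 0 < α) (hsf : Squarefree α) :
    IsCongruentNumber α ↔
      {P : ℚ × ℚ | (α : ℚ) * P.2 ^ 2 = P.1 ^ 3 - P.1}.Infinite := by
  have hα' : (0 : ℚ) < α := by exact_mod_cast hα
  constructor
  · rintro ⟨a, b, c, ha, hb, hc, h, harea⟩
    refine infinite_of_point α hα'.ne' ((a + c) / b) (2 * (a + c) / b ^ 2) ?_ (by positivity)
    rw [harea]
    field_simp
    linear_combination h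
  · intro hinf
    have : ∃ P ∈ {P : ℚ × ℚ | (α : ℚ) * P.2 ^ 2 = P.1 ^ 3 - P.1}, P.2 ≠ 0 := by
      by_contra! hcon
      refine hinf ((Set.toFinite ({(0, 0), (1, 0), (-1, 0)} : Set (ℚ × ℚ))).subset ?_)
      rintro ⟨x, y⟩ hP
      have hy : y = 0 := hcon _ hP
      subst hy
      have hP' : (α : ℚ) * 0 ^ 2 = x ^ 3 - x := hP
      have h2 : x * (x - 1) * (x + 1) = 0 := by linear_combination -hP'
      rcases mul_eq_zero.1 h2 with h3 | h3
      · rcases mul_eq_zero.1 h3 with h4 | h4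
        · simp [h4]
        · simp [sub_eq_zero.1 h4]
      · simp [eq_neg_of_add_eq_zero_left h3]
    obtain ⟨⟨x, y⟩, hP, hy⟩ := this
    have hP' : (α : ℚ) * y ^ 2 = x ^ 3 - x := hP
    have hy' : y ≠ 0 := hy
    have hd : x ^ 3 - x ≠ 0 := by rw [← hP']; positivity
    have hx0 : x ≠ 0 := by rintro rfl; simp at hd
    have hx1 : x ^ 2 - 1 ≠ 0 := by
      intro h1; apply hd; linear_combination x * h1
    refine ⟨|(x ^ 2 - 1) / y|, |2 * x / y|, |(x ^ 2 + 1) / y|, ?_, ?_, ?_, ?_, ?_⟩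
    · rw [abs_pos]; exact div_ne_zero hx1 hy'
    · rw [abs_pos]; positivity
    · rw [abs_pos]; positivity
    · simp only [sq_abs]
      field_simp
      ring
    · rw [← abs_mul]
      have : (x ^ 2 - 1) / y * (2 * x / y) = 2 * α := by
        field_simp
        linear_combination -hP'
      rw [this, abs_of_pos (by positivity)]
      ring
end

section
/- If p is a prime number with p ≡ 3 (mod 8), then p is not a congruent number. -/
theorem aux_sq {x y : ℤ} (hx : 0 < x) (hy : 0 < y) (h : IsCoprime x y) (hs : IsSquare (x * y)) :
    IsSquare x ∧ IsSquare y := by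
  have key : ∀ x y : ℤ, 0 < x → 0 < y → IsCoprime x y → IsSquare (x * y) → IsSquare x := by
    intro x y hx hy h hs
    obtain ⟨k, hk⟩ := hs
    obtain ⟨a, ha | ha⟩ := Int.sq_of_isCoprime (a := x) (b := y) (c := k) h (by rw [hk]; ring)
    · exact ⟨a, by rw [ha]; ring⟩
    · nlinarith [sq_nonneg a]
  exact ⟨key x y hx hy h hs, key y x hy hx h.symm (by rwa [mul_comm])⟩

theorem aux_div {d x : ℤ} (hd : d ≠ 0) (h : IsSquare (d ^ 2 * x)) : IsSquare x := by
  obtain ⟨k, hk⟩ := h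
  have h1 : d ^ 2 ∣ k ^ 2 := ⟨x, by rw [hk]; ring⟩
  rw [Int.pow_dvd_pow_iff (by norm_num)] at h1
  obtain ⟨r, rfl⟩ := h1
  refine ⟨r, ?_⟩
  have : d ^ 2 ≠ 0 := pow_ne_zero _ hd
  apply mul_left_cancel₀ this
  rw [hk]; ring

theorem aux_p {p x : ℤ} (hp : Prime p) (h : IsSquare (p * x)) : ∃ w, x = p * w ^ 2 := by
  obtain ⟨k, hk⟩ := h
  have h1 : p ∣ k := by
    have : p ∣ k * k := ⟨x, hk.symm⟩
    rcases hp.dvd_or_dvd this with h | h <;> exact h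
  obtain ⟨w, rfl⟩ := h1
  refine ⟨w, ?_⟩
  apply mul_left_cancel₀ hp.ne_zero
  rw [hk]; ring

theorem aux_split {p x y : ℤ} (hp : Prime p) (hp0 : 0 < p) (hx : 0 < x) (hy : 0 < y)
    (h : IsCoprime x y) (hs : IsSquare (p * (x * y))) :
    (IsSquare x ∧ IsSquare (p * y)) ∨ (IsSquare (p * x) ∧ IsSquare y) := by
  have key : ∀ x y : ℤ, 0 < x → 0 < y → IsCoprime x y → IsSquare (p * (x * y)) → p ∣ y →
      IsSquare x ∧ IsSquare (p * y) := by
    rintro x y hx hy h hs ⟨z, rfl⟩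
    have h1 : IsSquare (x * z) := aux_div hp.ne_zero (by convert hs using 1; ring)
    obtain ⟨h2, ⟨w, hw⟩⟩ := aux_sq hx (pos_of_mul_pos_right hy hp0.le)
      (h.of_mul_right_right) h1
    exact ⟨h2, p * w, by rw [hw]; ring⟩
  obtain ⟨w, hw⟩ := aux_p hp hs
  have : p ∣ x * y := ⟨_, hw⟩
  rcases hp.dvd_or_dvd this with h1 | h1
  · exact Or.inr (key y x hy hx h.symm (by rwa [mul_comm y x]) h1).symm
  · exact Or.inl (key x y hx hy h hs h1)

/-- a prime `3 mod 4` dividing a sum of two squares divides both -/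
theorem aux_sum {p : ℕ} (hp : p.Prime) (hmod : p % 8 = 3) {x y : ℤ}
    (h : (p : ℤ) ∣ x ^ 2 + y ^ 2) : (p : ℤ) ∣ y := by
  have := Fact.mk hp
  by_contra hy
  have hy' : (y : ZMod p) ≠ 0 := by rwa [Ne, ZMod.intCast_zmod_eq_zero_iff_dvd]
  have h' : ((x ^ 2 + y ^ 2 : ℤ) : ZMod p) = 0 := by rwa [ZMod.intCast_zmod_eq_zero_iff_dvd]
  push_cast at h'
  have : IsSquare (-1 : ZMod p) := by
    refine ⟨x / y, ?_⟩
    field_simp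
    linear_combination -h'
  rw [ZMod.exists_sq_eq_neg_one_iff] at this
  omega

theorem sqmod (x : ℤ) : (x ^ 2) % 8 = 0 ∨ x ^ 2 % 8 = 1 ∨ x ^ 2 % 8 = 4 := by
  have : x % 8 = 0 ∨ x % 8 = 1 ∨ x % 8 = 2 ∨ x % 8 = 3 ∨ x % 8 = 4 ∨ x % 8 = 5 ∨ x % 8 = 6 ∨
    x % 8 = 7 := by omega
  rcases this with h | h | h | h | h | h | h | h <;> simp [pow_two, Int.mul_emod, h]

theorem step {p : ℕ} (hp : p.Prime) (hmod : p % 8 = 3) {m n : ℤ} (hn : 0 < n) (hmn : n < m)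
    (hc : IsCoprime m n) (hpar : (m + n) % 2 = 1)
    (hs : IsSquare ((p : ℤ) * (m * n * ((m - n) * (m + n))))) :
    ∃ a b c : ℤ, 0 < a ∧ 0 < b ∧ 0 < c ∧ a ^ 2 + b ^ 2 = c ^ 2 ∧ IsSquare (2 * p * (a * b)) ∧
      c < m ^ 2 + n ^ 2 := by
  have hP : Prime (p : ℤ) := Nat.prime_iff_prime_int.mp hp
  have hp3 : (3 : ℤ) ≤ p := by omega
  have c1 : IsCoprime m (m - n) := by
    obtain ⟨u, v, h⟩ := hc
    exact ⟨u + v, -v, by linear_combination h⟩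
  have c2 : IsCoprime m (m + n) := by
    obtain ⟨u, v, h⟩ := hc
    exact ⟨u - v, v, by linear_combination h⟩
  have c3 : IsCoprime n (m - n) := by
    obtain ⟨u, v, h⟩ := hc
    exact ⟨u + v, u, by linear_combination h⟩
  have c4 : IsCoprime n (m + n) := by
    obtain ⟨u, v, h⟩ := hc
    exact ⟨v - u, u, by linear_combination h⟩
  have c5 : IsCoprime (m - n) (m + n) := by
    have h2 : IsCoprime (2 : ℤ) (m + n) := ⟨-((m + n) / 2), 1, by omega⟩
    have h3 : IsCoprime (2 * m) (m + n) := h2.mul_left c2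
    obtain ⟨u, v, h⟩ := h3
    exact ⟨u, u + v, by linear_combination h⟩
  have hm : 0 < m := by omega
  have hmn' : 0 < m - n := by omega
  have hmp : 0 < m + n := by omega
  have nun : ¬ IsUnit (p : ℤ) := hP.not_isUnit
  rcases aux_split hP (by omega) (by positivity) (by positivity)
    (IsCoprime.mul_left (c1.mul_right c2) (c3.mul_right c4)) hs with ⟨h1, h2⟩ | ⟨h1, h2⟩
  · obtain ⟨⟨u, hu⟩, ⟨v, hv⟩⟩ := aux_sq hm hn hc h1
    rcases aux_split hP (by omega) hmn' hmp c5 h2 with ⟨⟨t, ht⟩, h4⟩ | ⟨h3, ⟨s, hs'⟩⟩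
    · exfalso
      obtain ⟨s, hs'⟩ := aux_p hP h4
      have h5 := aux_sum hp hmod (x := u) (y := v) ⟨s ^ 2, by linear_combination hs' - hu - hv⟩
      have h6 := aux_sum hp hmod (x := v) (y := u) ⟨s ^ 2, by linear_combination hs' - hu - hv⟩
      exact nun (hc.isUnit_of_dvd' (hu ▸ h6.mul_left u) (hv ▸ h5.mul_left v))
    · exfalso
      obtain ⟨t, ht⟩ := aux_p hP h3
      obtain ⟨q, hq⟩ : ∃ q : ℤ, (p : ℤ) = 8 * q + 3 := ⟨p / 8, by omega⟩
      have ht' : m - n = 8 * (q * t ^ 2) + 3 * t ^ 2 := by rw [ht, hq]; ring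
      have e1 := sqmod u
      have e2 := sqmod v
      have e3 := sqmod s
      have e4 := sqmod t
      rw [← pow_two] at hu hv hs'
      generalize q * t ^ 2 = z at ht'
      omega
  · rcases aux_split hP (by omega) hm hn hc h1 with ⟨⟨u, hu⟩, h4⟩ | ⟨h3, ⟨v, hv⟩⟩
    · obtain ⟨v, hv⟩ := aux_p hP h4
      obtain ⟨⟨t, ht⟩, ⟨s, hs'⟩⟩ := aux_sq hmn' hmp c5 h2
      have hs0 : s ≠ 0 := by rintro rfl; omega
      have ht0 : t ≠ 0 := by rintro rfl; omega
      have hu0 : u ≠ 0 := by rintro rfl; omega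
      have hlt : |t| < |s| := by rw [← sq_lt_sq]; nlinarith
      have ht1 : 0 < |t| := abs_pos.mpr ht0
      have hu1 : 0 < |u| := abs_pos.mpr hu0
      have as := sq_abs s
      have at' := sq_abs t
      have au := sq_abs u
      refine ⟨|s| + |t|, |s| - |t|, 2 * |u|, by omega, by omega, by omega, ?_, ⟨2 * p * v, ?_⟩, ?_⟩
      · linear_combination 2 * as + 2 * at' - 4 * au - 2 * hs' - 2 * ht + 4 * hu
      · linear_combination 2 * p * as - 2 * p * at' - 2 * p * hs' + 2 * p * ht + 4 * p * hv
      · have : m = |u| ^ 2 := by rw [au, hu]; ring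
        have hn3 : 3 ≤ n := by
          have : 0 < v ^ 2 := by
            rcases (sq_nonneg v).lt_or_eq with h | h
            · exact h
            · rw [← h] at hv; omega
          nlinarith
        have q1 : 2 * |u| ≤ m + 1 := by
          rw [this]; linarith [sq_nonneg (|u| - 1)]
        have q2 : m ≤ m ^ 2 := le_self_pow₀ (by omega) (by norm_num)
        have q3 : n ≤ n ^ 2 := le_self_pow₀ (by omega) (by norm_num)
        omega
    · exfalso
      obtain ⟨u, hu⟩ := aux_p hP h3
      obtain ⟨⟨t, ht⟩, ⟨s, hs'⟩⟩ := aux_sq hmn' hmp c5 h2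
      have h5 := aux_sum hp hmod (x := s) (y := t)
        ⟨2 * u ^ 2, by linear_combination 2 * hu - hs' - ht⟩
      have h6 := aux_sum hp hmod (x := t) (y := s)
        ⟨2 * u ^ 2, by linear_combination 2 * hu - hs' - ht⟩
      exact nun (c5.isUnit_of_dvd' (ht ▸ h5.mul_left t) (hs' ▸ h6.mul_left s))

theorem step_odd {p : ℕ} (hp : p.Prime) (hmod : p % 8 = 3) {a b c : ℤ} (ha : 0 < a) (hb : 0 < b)
    (hc : 0 < c) (h : a ^ 2 + b ^ 2 = c ^ 2) (hg : Int.gcd a b = 1) (hodd : a % 2 = 1)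
    (hs : IsSquare (2 * p * (a * b))) :
    ∃ a b c' : ℤ, 0 < a ∧ 0 < b ∧ 0 < c' ∧ a ^ 2 + b ^ 2 = c' ^ 2 ∧ IsSquare (2 * p * (a * b)) ∧
      c' < c := by
  have ht : PythagoreanTriple a b c := by unfold PythagoreanTriple; linear_combination h
  obtain ⟨m, n, h1, h2, h3, h4, h5, h6⟩ := ht.coprime_classification' hg hodd hc
  have hm : 0 < m := by
    rcases h6.lt_or_eq with h | h
    · exact h
    · subst h; simp at h2; omega
  have hn : 0 < n := by
    by_contra hn
    nlinarith
  have hlt : n < m := by nlinarith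
  rw [h3]
  refine step hp hmod hn hlt (Int.isCoprime_iff_gcd_eq_one.mpr h4) (by omega) ?_
  apply aux_div (d := 2) (by norm_num)
  convert hs using 1
  rw [h1, h2]; ring

theorem descent {p : ℕ} (hp : p.Prime) (hmod : p % 8 = 3) (N : ℕ) : ∀ a b c : ℤ, 0 < a → 0 < b →
    0 < c → a ^ 2 + b ^ 2 = c ^ 2 → IsSquare (2 * p * (a * b)) → c ≤ N → False := by
  induction N with
  | zero => intro a b c _ _ hc _ _ h; simp at h; omega
  | succ N ih =>
    intro a b c ha hb hc h hs hN
    have hg0 : 0 < Int.gcd a b := Int.gcd_pos_of_ne_zero_left _ ha.ne'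
    obtain ⟨a', b', hg, ha', hb'⟩ := Int.exists_gcd_one hg0
    generalize hG : (Int.gcd a b : ℤ) = g at *
    have hg1 : 0 < g := by omega
    have hcg : g ∣ c := by
      rw [← Int.pow_dvd_pow_iff (n := 2) (by norm_num), ← h, ha', hb']
      exact ⟨a' ^ 2 + b' ^ 2, by ring⟩
    obtain ⟨c', hc'⟩ := hcg
    have ha1 : 0 < a' := by nlinarith
    have hb1 : 0 < b' := by nlinarith
    have hc1 : 0 < c' := by nlinarith
    have hle : c' ≤ c := by nlinarith
    have h1 : a' ^ 2 + b' ^ 2 = c' ^ 2 := by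
      apply mul_left_cancel₀ (pow_ne_zero 2 hg1.ne')
      rw [ha', hb', hc'] at h
      linear_combination h
    have hs1 : IsSquare (2 * p * (a' * b')) := by
      apply aux_div hg1.ne'
      convert hs using 1
      rw [ha', hb']; ring
    have : a' % 2 = 1 ∨ b' % 2 = 1 := by
      by_contra hcon
      have := Int.dvd_coe_gcd (a := a') (b := b') (c := 2) (by omega) (by omega)
      rw [hg] at this
      omega
    rcases this with ho | ho
    · obtain ⟨x, y, z, hx, hy, hz, h2, h3, h4⟩ := step_odd hp hmod ha1 hb1 hc1 h1 hg ho hs1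
      exact ih x y z hx hy hz h2 h3 (by push_cast at hN; omega)
    · obtain ⟨x, y, z, hx, hy, hz, h2, h3, h4⟩ := step_odd hp hmod hb1 ha1 hc1
        (by rw [add_comm, h1]) (by rwa [Int.gcd_comm]) ho (by rwa [mul_comm b' a'])
      exact ih x y z hx hy hz h2 h3 (by push_cast at hN; omega)

/-- Genocchi (1874): a prime `p ≡ 3 (mod 8)` is not a congruent number. -/
theorem prime_three_mod_eight_not_congruent (p : ℕ) (hp : p.Prime) (hmod : p % 8 = 3) :
    ¬ IsCongruentNumber p := by
  rintro ⟨a, b, c, ha, hb, hc, h, hA⟩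
  have ea := Rat.num_div_den a
  have eb := Rat.num_div_den b
  have ec := Rat.num_div_den c
  have pa : (0 : ℤ) < a.den := by exact_mod_cast a.den_pos
  have pb : (0 : ℤ) < b.den := by exact_mod_cast b.den_pos
  have pc : (0 : ℤ) < c.den := by exact_mod_cast c.den_pos
  have na : 0 < a.num := Rat.num_pos.mpr ha
  have nb : 0 < b.num := Rat.num_pos.mpr hb
  have nc : 0 < c.num := Rat.num_pos.mpr hc
  have da : (a.den : ℚ) ≠ 0 := by exact_mod_cast pa.ne'
  have db : (b.den : ℚ) ≠ 0 := by exact_mod_cast pb.ne'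
  have dc : (c.den : ℚ) ≠ 0 := by exact_mod_cast pc.ne'
  have fa : (a.num : ℚ) = a * a.den := by rw [← Rat.mul_den_eq_num a]
  have fb : (b.num : ℚ) = b * b.den := by rw [← Rat.mul_den_eq_num b]
  have fc : (c.num : ℚ) = c * c.den := by rw [← Rat.mul_den_eq_num c]
  refine descent hp hmod (c.num * a.den * b.den).toNat (a.num * b.den * c.den)
    (b.num * a.den * c.den) (c.num * a.den * b.den) (by positivity) (by positivity)
    (by positivity) ?_ ⟨2 * p * a.den * b.den * c.den, ?_⟩ (Int.self_le_toNat _)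
  · have : ((a.num * b.den * c.den : ℚ)) ^ 2 + (b.num * a.den * c.den) ^ 2
        = (c.num * a.den * b.den) ^ 2 := by
      rw [fa, fb, fc]
      linear_combination (a.den * b.den * c.den : ℚ) ^ 2 * h
    exact_mod_cast this
  · have : (2 * p * ((a.num * b.den * c.den) * (b.num * a.den * c.den)) : ℚ)
        = (2 * p * a.den * b.den * c.den) * (2 * p * a.den * b.den * c.den) := by
      rw [fa, fb]
      linear_combination -4 * p * (a.den * b.den * c.den : ℚ) ^ 2 * hA
    exact_mod_cast this
end

section
/- If p is a prime number with p ≡ 5 (mod 8), then 2p is not a congruent number. -/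
lemma sq_split {a b c : ℤ} (ha : 0 < a) (hb : 0 < b) (h : IsCoprime a b) (e : a * b = c ^ 2) :
    (∃ r : ℤ, a = r ^ 2) ∧ ∃ s : ℤ, b = s ^ 2 := by
  constructor
  · obtain ⟨r, hr | hr⟩ := Int.sq_of_isCoprime h e
    · exact ⟨r, hr⟩
    · nlinarith [sq_nonneg r]
  · obtain ⟨r, hr | hr⟩ := Int.sq_of_isCoprime h.symm (by rw [mul_comm]; exact e)
    · exact ⟨r, hr⟩
    · nlinarith [sq_nonneg r]

lemma prime_split_aux {p : ℤ} (hp : Prime p) (hp0 : 0 < p) {a b c : ℤ} (ha : 0 < a) (hb : 0 < b)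
    (h : IsCoprime a b) (e : a * b = p * c ^ 2) (hd : p ∣ a) :
    ∃ r s : ℤ, a = p * r ^ 2 ∧ b = s ^ 2 := by
  obtain ⟨a', rfl⟩ := hd
  have e' : a' * b = c ^ 2 := by
    apply mul_left_cancel₀ hp.ne_zero
    rw [← e]; ring
  obtain ⟨⟨r, hr⟩, s, hs⟩ := sq_split (pos_of_mul_pos_right ha hp0.le) hb h.of_mul_left_right e'
  exact ⟨r, s, by rw [hr], hs⟩

lemma prime_split {p : ℤ} (hp : Prime p) (hp0 : 0 < p) {a b c : ℤ} (ha : 0 < a) (hb : 0 < b)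
    (h : IsCoprime a b) (e : a * b = p * c ^ 2) :
    (∃ r s : ℤ, a = p * r ^ 2 ∧ b = s ^ 2) ∨ ∃ r s : ℤ, a = r ^ 2 ∧ b = p * s ^ 2 := by
  have hd : p ∣ a * b := ⟨_, e⟩
  rcases hp.dvd_or_dvd hd with hd | hd
  · exact Or.inl (prime_split_aux hp hp0 ha hb h e hd)
  · obtain ⟨r, s, h1, h2⟩ := prime_split_aux hp hp0 hb ha h.symm (by rw [mul_comm]; exact e) hd
    exact Or.inr ⟨s, r, h2, h1⟩

lemma sq_mod_eight {r : ℤ} (h : r ^ 2 % 2 = 1) : r ^ 2 % 8 = 1 := by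
  rcases Int.even_or_odd r with hr | hr
  · obtain ⟨k, rfl⟩ := hr
    ring_nf at h
    omega
  · obtain ⟨k, rfl⟩ := hr
    obtain ⟨t, ht⟩ := Int.even_mul_succ_self k
    have : (2 * k + 1) ^ 2 = 8 * t + 1 := by linear_combination 4 * ht
    omega

lemma mul_sq_mod_eight {p r : ℤ} (hp : p % 8 = 5) (h : (p * r ^ 2) % 2 = 1) :
    (p * r ^ 2) % 8 = 5 := by
  have h2 : r ^ 2 % 2 = 1 := by
    rw [Int.mul_emod] at h
    rcases Int.emod_two_eq_zero_or_one (r ^ 2) with h0 | h0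
    · rw [h0] at h; simp at h
    · exact h0
  rw [Int.mul_emod, hp, sq_mod_eight h2]
  norm_num

lemma two_nonres {p : ℕ} (hp : p.Prime) (hmod : p % 8 = 5) {m u v r : ℤ}
    (h1 : m = p * u ^ 2) (h2 : m + 2 * v ^ 2 = r ^ 2) (hv : IsCoprime m v) : False := by
  have : Fact p.Prime := ⟨hp⟩
  have hp2 : p ≠ 2 := by rintro rfl; omega
  have hm0 : (m : ZMod p) = 0 := by rw [h1]; simp
  have hv0 : (v : ZMod p) ≠ 0 := by
    intro h0
    obtain ⟨a, b, hab⟩ := hv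
    have := congrArg (Int.cast : ℤ → ZMod p) hab
    push_cast at this
    rw [hm0, h0] at this
    simp at this
  have e := congrArg (Int.cast : ℤ → ZMod p) h2
  push_cast at e
  rw [hm0, zero_add] at e
  have : IsSquare (2 : ZMod p) := ⟨r / v, by field_simp; linear_combination e⟩
  rw [ZMod.exists_sq_eq_two_iff hp2] at this
  omega

lemma even_of {s t : ℤ} (h : 4 * t = s ^ 2) : ∃ k, s = 2 * k := by
  have : (2 : ℤ) ∣ s ^ 2 := ⟨2 * t, by rw [← h]; ring⟩
  exact Int.prime_two.dvd_of_dvd_pow this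

lemma descent_s6 {m n' a b u : ℤ} (hm0 : 0 < m) (hn' : 0 < n') (ha : m + 2 * n' = a ^ 2)
    (hb : m - 2 * n' = b ^ 2) (hu : m = u ^ 2) (q1 : (m - 2 * n') % 8 = 1)
    (q2 : (m + 2 * n') % 8 = 1) :
    ∃ X Y U : ℤ, 0 < X ∧ 0 < Y ∧ 0 < U ∧ U < m ^ 2 + (2 * n') ^ 2 ∧ X ^ 2 + Y ^ 2 = U ^ 2 ∧
      X * Y = n' := by
  have ha2 : |a| ^ 2 = m + 2 * n' := by rw [sq_abs, ha]
  have hb2 : |b| ^ 2 = m - 2 * n' := by rw [sq_abs, hb]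
  have hu2 : |u| ^ 2 = m := by rw [sq_abs, hu]
  have hu0 : 0 < |u| := by
    rw [abs_pos]; rintro rfl; simp at hu; omega
  generalize |u| = U at *
  have ha0 : 0 ≤ |a| := abs_nonneg a
  have hb0 : 0 ≤ |b| := abs_nonneg b
  generalize |a| = A at *
  generalize |b| = B at *
  have hAB : B < A := lt_of_pow_lt_pow_left₀ 2 ha0 (by omega)
  have pA : A % 2 = 1 := by
    rcases Int.emod_two_eq_zero_or_one A with h0 | h0
    · obtain ⟨t, rfl⟩ : ∃ t, A = 2 * t := ⟨A / 2, by omega⟩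
      ring_nf at ha2; omega
    · exact h0
  have pB : B % 2 = 1 := by
    rcases Int.emod_two_eq_zero_or_one B with h0 | h0
    · obtain ⟨t, rfl⟩ : ∃ t, B = 2 * t := ⟨B / 2, by omega⟩
      ring_nf at hb2; omega
    · exact h0
  obtain ⟨X, hX⟩ : ∃ X, A - B = 2 * X := ⟨(A - B) / 2, by omega⟩
  obtain ⟨rfl⟩ : A = B + 2 * X := by omega
  refine ⟨X, B + X, U, by omega, by omega, hu0, ?_, ?_, ?_⟩
  · have : U ≤ m := by nlinarith
    nlinarith
  · linarith
  · linarith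

lemma step_s6 {p : ℕ} (hp : p.Prime) (hmod : p % 8 = 5) {x y z w : ℤ} (hx : 0 < x) (hy : 0 < y)
    (hz : 0 < z) (hc : IsCoprime x y) (h : x ^ 2 + y ^ 2 = z ^ 2) (e : x * y = p * w ^ 2)
    (hodd : x % 2 = 1) :
    ∃ x' y' z' w' : ℤ, 0 < x' ∧ 0 < y' ∧ 0 < z' ∧ z' < z ∧ x' ^ 2 + y' ^ 2 = z' ^ 2 ∧
      x' * y' = p * w' ^ 2 := by
  have hpI : Prime (p : ℤ) := Nat.prime_iff_prime_int.mp hp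
  have hp0 : (0 : ℤ) < p := by exact_mod_cast hp.pos
  have hp8 : (p : ℤ) % 8 = 5 := by omega
  have hP : PythagoreanTriple x y z := by unfold PythagoreanTriple; linear_combination h
  obtain ⟨m, n, h1, h2, h3, hg, hpar, hm⟩ :=
    hP.coprime_classification' (Int.isCoprime_iff_gcd_eq_one.mp hc) hodd hz
  have hmn : IsCoprime m n := Int.isCoprime_iff_gcd_eq_one.mpr hg
  have hmn0 : 0 < m * n := by nlinarith
  have hm0 : 0 < m := by
    rcases hm.lt_or_eq with h | h
    · exact h
    · rw [← h] at hmn0; simp at hmn0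
  have hn0 : 0 < n := pos_of_mul_pos_right hmn0 hm
  have hlt : 0 < m - n := by nlinarith
  have hfac : x = (m - n) * (m + n) := by rw [h1]; ring
  have hcop : IsCoprime (m - n) (m + n) := by
    obtain ⟨a, b, hab⟩ := hmn
    obtain ⟨k, hk⟩ : ∃ k, m - n = 2 * k + 1 := ⟨(m - n) / 2, by omega⟩
    have h2' : IsCoprime (m - n) 2 := ⟨1, -k, by rw [hk]; ring⟩
    have hmm : IsCoprime (m - n) m := ⟨-b, a + b, by linear_combination hab⟩
    have := (h2'.mul_right hmm).add_mul_left_right (-1)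
    have hh : m + n = 2 * m + (m - n) * (-1) := by ring
    rw [hh]
    exact this
  have hparm : (m - n) % 2 = 1 := by omega
  have hparp : (m + n) % 2 = 1 := by omega
  rcases prime_split hpI hp0 hx hy hc e with ⟨r, s, hr, hs⟩ | ⟨r, s, hr, hs⟩
  · exfalso
    have hm3 : m % 4 = 3 := by
      rcases prime_split hpI hp0 hlt (by omega) hcop (hfac.symm.trans hr) with
        ⟨a, b, ha, hb⟩ | ⟨a, b, ha, hb⟩
      · have q1 := mul_sq_mod_eight hp8 (ha ▸ hparm)
        have q2 := sq_mod_eight (hb ▸ hparp)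
        rw [← ha] at q1; rw [← hb] at q2
        omega
      · have q1 := mul_sq_mod_eight hp8 (hb ▸ hparp)
        have q2 := sq_mod_eight (ha ▸ hparm)
        rw [← hb] at q1; rw [← ha] at q2
        omega
    obtain ⟨n', rfl⟩ : ∃ n', n = 2 * n' := ⟨n / 2, by omega⟩
    obtain ⟨k, rfl⟩ := even_of (s := s) (t := m * n') (by rw [← hs, h2]; ring)
    obtain ⟨⟨u, hu⟩, -⟩ := sq_split (c := k) hm0 (by omega : 0 < n') hmn.of_mul_right_right
      (by linarith)
    have := sq_mod_eight (r := u) (by omega)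
    omega
  · obtain ⟨⟨b, hb⟩, a, ha⟩ := sq_split hlt (by omega) hcop (hfac.symm.trans hr)
    have q1 := sq_mod_eight (hb ▸ hparm)
    have q2 := sq_mod_eight (ha ▸ hparp)
    rw [← hb] at q1; rw [← ha] at q2
    obtain ⟨n', rfl⟩ : ∃ n', n = 2 * n' := ⟨n / 2, by omega⟩
    have hs2 : ∃ k, s = 2 * k := by
      have hev : (2 : ℤ) ∣ p * s ^ 2 := ⟨m * (2 * n'), by rw [← hs, h2]; ring⟩
      rcases Int.prime_two.dvd_or_dvd hev with hh | hh
      · omega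
      · exact Int.prime_two.dvd_of_dvd_pow hh
    obtain ⟨k, rfl⟩ := hs2
    have hn' : 0 < n' := by omega
    have hcop' : IsCoprime m n' := hmn.of_mul_right_right
    have e2 : m * n' = p * k ^ 2 := by linarith
    rcases prime_split hpI hp0 hm0 hn' hcop' e2 with ⟨u, v, hu, hv⟩ | ⟨u, v, hu, hv⟩
    · exfalso
      refine two_nonres hp hmod hu (v := v) (r := a) (by rw [← ha, hv]) ?_
      rw [hv, sq] at hcop'
      exact hcop'.of_mul_right_left
    · obtain ⟨X, Y, U, h4, h5, h6, h7, h8, h9⟩ := descent_s6 hm0 hn' ha hb hu (by omega) (by omega)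
      exact ⟨X, Y, U, v, h4, h5, h6, by rw [h3]; exact h7, h8, by rw [h9, hv]⟩

lemma no_sol {p : ℕ} (hp : p.Prime) (hmod : p % 8 = 5) (N : ℕ) : ∀ {x y z w : ℤ}, 0 < x → 0 < y →
    0 < z → z ≤ N → x ^ 2 + y ^ 2 = z ^ 2 → x * y = p * w ^ 2 → False := by
  have hpI : Prime (p : ℤ) := Nat.prime_iff_prime_int.mp hp
  induction N with
  | zero => intro x y z w _ _ h1 h2; simp at h2; omega
  | succ N ih =>
    intro x y z w hx hy hz hN h e
    -- reduce to the coprime case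
    obtain ⟨x', y', hc, hx', hy'⟩ : ∃ x' y' : ℤ, IsCoprime x' y' ∧
        x = Int.gcd x y * x' ∧ y = Int.gcd x y * y' := by
      have hg : 0 < Int.gcd x y := Int.gcd_pos_of_ne_zero_left _ hx.ne'
      obtain ⟨x', y', hc, h1, h2⟩ := Int.exists_gcd_one hg
      exact ⟨x', y', Int.isCoprime_iff_gcd_eq_one.mpr hc, by rw [mul_comm]; exact h1,
        by rw [mul_comm]; exact h2⟩
    have hg0 : (0 : ℤ) < Int.gcd x y := by
      exact_mod_cast Int.gcd_pos_of_ne_zero_left _ hx.ne'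
    generalize (Int.gcd x y : ℤ) = g at *
    subst hx' hy'
    have hx0 := pos_of_mul_pos_right hx hg0.le
    have hy0 := pos_of_mul_pos_right hy hg0.le
    obtain ⟨z', rfl⟩ : g ∣ z := by
      rw [← Int.pow_dvd_pow_iff two_ne_zero]
      exact ⟨x' ^ 2 + y' ^ 2, by rw [← h]; ring⟩
    have hz0 := pos_of_mul_pos_right hz hg0.le
    have hgw : g ∣ w := by
      have hsq : Squarefree (p : ℤ) := hpI.squarefree
      obtain ⟨g', w', hc', h1, h2⟩ := Int.exists_gcd_one (Int.gcd_pos_of_ne_zero_left w hg0.ne')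
      have hc'' : IsCoprime g' w' := Int.isCoprime_iff_gcd_eq_one.mpr hc'
      have hd0 : (Int.gcd g w : ℤ) ≠ 0 := by
        exact_mod_cast (Int.gcd_pos_of_ne_zero_left w hg0.ne').ne'
      generalize (Int.gcd g w : ℤ) = d at *
      have hd : g' ^ 2 ∣ p * w' ^ 2 := by
        refine ⟨x' * y', mul_left_cancel₀ (pow_ne_zero 2 hd0) ?_⟩
        rw [h1, h2] at e
        linear_combination -e
      have hd2 : g' * g' ∣ (p : ℤ) := by
        rw [← sq]; exact (hc''.pow (m := 2) (n := 2)).dvd_of_dvd_mul_right hd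
      rw [h1, h2]
      exact mul_dvd_mul_right (hsq _ hd2).dvd _
    obtain ⟨w', rfl⟩ := hgw
    have e' : x' * y' = p * w' ^ 2 := by
      apply mul_left_cancel₀ (pow_ne_zero 2 hg0.ne'); linear_combination e
    have h' : x' ^ 2 + y' ^ 2 = z' ^ 2 := by
      apply mul_left_cancel₀ (pow_ne_zero 2 hg0.ne'); linear_combination h
    have hz1 : z' ≤ g * z' := by nlinarith
    have key : ∃ x' y' z'' w' : ℤ, 0 < x' ∧ 0 < y' ∧ 0 < z'' ∧ z'' < z' ∧
        x' ^ 2 + y' ^ 2 = z'' ^ 2 ∧ x' * y' = p * w' ^ 2 := by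
      rcases Int.emod_two_eq_zero_or_one x' with h0 | h0
      · have h1 : y' % 2 = 1 := by
          obtain ⟨a, b, hab⟩ := hc
          rcases Int.emod_two_eq_zero_or_one y' with h1 | h1
          · exfalso
            obtain ⟨s, rfl⟩ : ∃ s, x' = 2 * s := ⟨x' / 2, by omega⟩
            obtain ⟨t, rfl⟩ : ∃ t, y' = 2 * t := ⟨y' / 2, by omega⟩
            have : 2 * (a * s + b * t) = 1 := by linear_combination hab
            omega
          · exact h1
        exact step_s6 hp hmod hy0 hx0 hz0 hc.symm (by rw [add_comm]; exact h')
          (by rw [mul_comm]; exact e') h1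
      · exact step_s6 hp hmod hx0 hy0 hz0 hc h' e' h0
    obtain ⟨a, b, c, d, ha, hb, hc0, hcz, h5, h6⟩ := key
    exact ih ha hb hc0 (by push_cast at hN; omega) h5 h6

/-- Genocchi (1874): for a prime `p ≡ 5 (mod 8)`, `2p` is not a congruent number. -/
theorem two_mul_prime_five_mod_eight_not_congruent (p : ℕ) (hp : p.Prime) (hmod : p % 8 = 5) :
    ¬ IsCongruentNumber (2 * p) := by
  rintro ⟨a, b, c, ha, hb, hc, h, e⟩
  have ea := Rat.num_div_den a
  have eb := Rat.num_div_den b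
  have ec := Rat.num_div_den c
  have hna := Rat.num_pos.mpr ha
  have hnb := Rat.num_pos.mpr hb
  have hnc := Rat.num_pos.mpr hc
  have hda : (0 : ℤ) < a.den := by exact_mod_cast a.den_pos
  have hdb : (0 : ℤ) < b.den := by exact_mod_cast b.den_pos
  have hdc : (0 : ℤ) < c.den := by exact_mod_cast c.den_pos
  have qa : (a.den : ℚ) ≠ 0 := by exact_mod_cast hda.ne'
  have qb : (b.den : ℚ) ≠ 0 := by exact_mod_cast hdb.ne'
  have qc : (c.den : ℚ) ≠ 0 := by exact_mod_cast hdc.ne'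
  have ea' : (a.num : ℚ) = a * a.den := by rw [Rat.mul_den_eq_num]
  have eb' : (b.num : ℚ) = b * b.den := by rw [Rat.mul_den_eq_num]
  have ec' : (c.num : ℚ) = c * c.den := by rw [Rat.mul_den_eq_num]
  push_cast at e
  refine no_sol hp hmod (c.num * (a.den * b.den)).toNat (x := a.num * (b.den * c.den))
    (y := b.num * (a.den * c.den)) (z := c.num * (a.den * b.den))
    (w := 2 * a.den * b.den * c.den) (by positivity) (by positivity) (by positivity)
    (Int.self_le_toNat _) ?_ ?_
  · have : ((a.num * (b.den * c.den) : ℚ)) ^ 2 + (b.num * (a.den * c.den)) ^ 2 =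
        (c.num * (a.den * b.den)) ^ 2 := by
      rw [ea', eb', ec']
      linear_combination (a.den * b.den * c.den : ℚ) ^ 2 * h
    exact_mod_cast this
  · have : ((a.num * (b.den * c.den) : ℚ)) * (b.num * (a.den * c.den)) =
        p * (2 * a.den * b.den * c.den) ^ 2 := by
      rw [ea', eb']
      linear_combination (-2 * (a.den * b.den * c.den : ℚ) ^ 2) * e
    exact_mod_cast this
end

section
/- There exists an elliptic curve E over ℚ such that rk_ℤ E(ℚ) > 27, i.e., the finitely generated abelian group E(ℚ) has rank at least 28. -/
/-- The elliptic curve `y² = x³ + A₄x + A₆` over `ℚ`. -/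
noncomputable def Wcurve (A₄ A₆ : ℚ) : WeierstrassCurve.Affine ℚ :=
  { a₁ := 0, a₂ := 0, a₃ := 0, a₄ := A₄, a₆ := A₆ }

open WeierstrassCurve Height

section Heights

variable (a b : ℚ)

lemma Wc_nonsing {a b x y : ℚ} (h : (Wcurve a b).Nonsingular x y) :
    y ^ 2 = x ^ 3 + a * x + b ∧ (3 * x ^ 2 + a ≠ 0 ∨ y ≠ 0) := by
  rw [Affine.nonsingular_iff, Affine.equation_iff] at h
  simp only [Wcurve] at h
  obtain ⟨h1, h2⟩ := h
  refine ⟨by linarith, ?_⟩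
  rcases h2 with h2 | h2
  · left; intro h; apply h2; linarith
  · right; rintro rfl; apply h2; ring

lemma Wc_a1 : (Wcurve a b).a₁ = 0 := rfl

lemma Wc_a2 : (Wcurve a b).a₂ = 0 := rfl

lemma Wc_a3 : (Wcurve a b).a₃ = 0 := rfl

lemma Wc_negY (x y : ℚ) : (Wcurve a b).negY x y = -y := by
  simp [Affine.negY, Wcurve]

lemma Wc_slope_ne {x₁ x₂ : ℚ} (y₁ y₂ : ℚ) (h : x₁ ≠ x₂) :
    (Wcurve a b).slope x₁ x₂ y₁ y₂ = (y₁ - y₂) / (x₁ - x₂) := by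
  rw [Affine.slope_of_X_ne h]

lemma Wc_slope_self {x y : ℚ} (h : y ≠ 0) :
    (Wcurve a b).slope x x y y = (3 * x ^ 2 + a) / (2 * y) := by
  rw [Affine.slope_of_Y_ne rfl]
  · rw [Wc_negY]; simp [Wcurve]; ring
  · rw [Wc_negY]; intro h'; apply h; linarith

lemma Wc_addX (x₁ x₂ l : ℚ) : (Wcurve a b).addX x₁ x₂ l = l ^ 2 - x₁ - x₂ := by
  simp [Affine.addX, Wcurve]

lemma Wc_addSub_aux (v w : Fin 3 → ℚ) (t : ℚ) 
    (h0 : t * w 0 = v 0 ^ 2 - 2 * a * v 0 * v 2 - 4 * b * v 1 * v 2 + a ^ 2 * v 2 ^ 2)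
    (h1 : t * w 1 = 2 * v 1 * v 0 + 2 * a * v 1 * v 2 + 4 * b * v 2 ^ 2)
    (h2 : t * w 2 = v 1 ^ 2 - 4 * v 0 * v 2) :
    (fun i ↦ (addSubMap (Wcurve a b) i).eval v) = t • w := by
  funext i
  fin_cases i
  · simp [addSubMap, h0, b₂, b₄, b₆, b₈, Wcurve]
  · simp [addSubMap, h1, b₂, b₄, b₆, b₈, Wcurve]
  · simp [addSubMap, h2, b₂, b₄, b₆, b₈, Wcurve]

lemma Wc_addSub_self (P : (Wcurve a b).Point) :
    ∃ t : ℚ, t ≠ 0 ∧ (fun i ↦ (addSubMap (Wcurve a b) i).eval (P.sym2x P)) =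
      t • Affine.Point.sym2x (P + P) 0 := by
  match P with
  | 0 =>
    refine ⟨1, one_ne_zero, ?_⟩
    apply Wc_addSub_aux <;> simp
  | .some x y h =>
    obtain ⟨he, hn⟩ := Wc_nonsing h
    by_cases hy : y = 0
    · subst hy
      rw [Affine.Point.add_self_of_Y_eq (by rw [Wc_negY]; simp)]
      refine ⟨(3 * x ^ 2 + a) ^ 2, by simpa using hn, ?_⟩
      apply Wc_addSub_aux
      · simp; linear_combination (-8 * x) * he
      · simp; linear_combination 4 * he
      · simp; ring
    · rw [Affine.Point.add_self_of_Y_ne (by rw [Wc_negY]; intro h'; apply hy; linarith)]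
      refine ⟨4 * y ^ 2, by positivity, ?_⟩
      apply Wc_addSub_aux
      · simp [Wc_slope_self _ _ hy, Wc_a1, Wc_a2]; field_simp; linear_combination (-32 * x) * he
      · simp; linear_combination 4 * he
      · simp; ring

lemma Wc_addSub (P Q : (Wcurve a b).Point) :
    ∃ t : ℚ, t ≠ 0 ∧ (fun i ↦ (addSubMap (Wcurve a b) i).eval (P.sym2x Q)) =
      t • Affine.Point.sym2x (P + Q) (P - Q) := by
  by_cases hPQ : P = Q
  · subst hPQ
    simpa using Wc_addSub_self a b P
  by_cases hPQ' : P = -Q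
  · have := Wc_addSub_self a b P
    obtain rfl : Q = -P := by rw [hPQ', neg_neg]
    rw [Affine.Point.sym2x_neg_right, Affine.Point.sym2x_comm (P + -P)]
    simpa using this
  match P, Q with
  | 0, 0 => exact absurd rfl hPQ
  | 0, .some x y h =>
    refine ⟨1, one_ne_zero, ?_⟩
    rw [zero_add, zero_sub, Affine.Point.sym2x_neg_right]
    apply Wc_addSub_aux <;> simp <;> ring
  | .some x y h, 0 =>
    refine ⟨1, one_ne_zero, ?_⟩
    rw [add_zero, sub_zero]
    apply Wc_addSub_aux <;> simp <;> ring
  | .some x₁ y₁ h₁, .some x₂ y₂ h₂ =>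
    have hx : x₁ ≠ x₂ := by
      intro hx
      rcases Affine.Point.X_eq_iff.mp hx with h | h
      exacts [hPQ h, hPQ' h]
    obtain ⟨he₁, -⟩ := Wc_nonsing h₁
    obtain ⟨he₂, -⟩ := Wc_nonsing h₂
    have hx' := sub_ne_zero.mpr hx
    rw [sub_eq_add_neg, Affine.Point.neg_some, Affine.Point.add_some (by tauto),
      Affine.Point.add_some (by tauto)]
    refine ⟨(x₁ - x₂) ^ 2, by positivity, ?_⟩
    apply Wc_addSub_aux
    · simp [Wc_slope_ne _ _ _ _ hx, Wc_a1, Wc_a2, Wc_a3]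
      field_simp
      have e1 : (y₁ - y₂) ^ 2 * (y₁ + y₂) ^ 2 = (y₁ ^ 2 - y₂ ^ 2) ^ 2 := by ring
      have e2 : (y₁ - y₂) ^ 2 + (y₁ + y₂) ^ 2 = 2 * (y₁ ^ 2 + y₂ ^ 2) := by ring
      rw [he₁, he₂] at e1 e2
      linear_combination e1 - (x₁ - x₂) ^ 2 * (x₁ + x₂) * e2
    · simp [Wc_slope_ne _ _ _ _ hx, Wc_a1, Wc_a2, Wc_a3]
      field_simp
      linear_combination 2 * he₁ + 2 * he₂
    · simp; ring

/-- naive height -/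
noncomputable def nht {a b : ℚ} (P : (Wcurve a b).Point) : ℝ := logHeight P.xRep

lemma Wc_isElliptic {a b : ℚ} (h : 4 * a ^ 3 + 27 * b ^ 2 ≠ 0) :
    WeierstrassCurve.IsElliptic (Wcurve a b) := by
  refine ⟨isUnit_iff_ne_zero.mpr fun h0 => h ?_⟩
  simp [Δ, b₂, b₄, b₆, b₈, Wcurve] at h0
  linarith

lemma nht_parallelogram {a b : ℚ} (h : 4 * a ^ 3 + 27 * b ^ 2 ≠ 0) :
    ∃ C, ∀ P Q : (Wcurve a b).Point,
      |nht (P + Q) + nht (P - Q) - 2 * (nht P + nht Q)| ≤ C := by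
  have := Wc_isElliptic h
  obtain ⟨C₁, h₁⟩ := abs_logHeight_addSubMap_sub_two_mul_logHeight_le (Wcurve a b)
  obtain ⟨C₂, h₂⟩ := abs_logHeight_sym2_sub_le ℚ
  have key (P Q : (Wcurve a b).Point) : |logHeight (P.sym2x Q) - (nht P + nht Q)| ≤ C₂ := by
    have e (P : (Wcurve a b).Point) : P.xRep = ![P.xRep 0, P.xRep 1] := by
      ext i; fin_cases i <;> rfl
    have := h₂ (e P ▸ P.xRep_ne_zero) (e Q ▸ Q.xRep_ne_zero)
    rw [← e, ← e] at this
    exact this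
  refine ⟨C₁ + 3 * C₂, fun P Q => ?_⟩
  obtain ⟨t, ht, hh⟩ := Wc_addSub a b P Q
  have h1 := h₁ (P.sym2x Q)
  rw [hh, logHeight_smul_eq_logHeight _ ht] at h1
  have h2 := key P Q
  have h3 := key (P + Q) (P - Q)
  rw [abs_le] at *
  constructor <;> linarith [h1.1, h1.2, h2.1, h2.2, h3.1, h3.2]

lemma nht_northcott {a b : ℚ} : Northcott (nht (a := a) (b := b)) := by
  refine ⟨fun B => ?_⟩
  have hf := NumberField.finite_setOfPred_logHeight₁_le ℚ B
  refine (Set.Finite.of_finite_fibers (fun P : (Wcurve a b).Point => P.xRep) (s := {P | nht P ≤ B})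
    ?_ ?_)
  · refine ((hf.image (fun x => ![x, 1])).insert ![1, 0]).subset ?_
    rintro _ ⟨P, hP, rfl⟩
    match P with
    | 0 => left; rfl
    | .some x y h =>
      right
      refine ⟨x, ?_, rfl⟩
      simp only [nht, Affine.Point.xRep_some, Set.mem_ofPred_eq] at hP
      simpa [logHeight₁_eq_logHeight] using hP
  · intro v _
    by_cases hv : ∃ P : (Wcurve a b).Point, P.xRep = v
    · obtain ⟨P, rfl⟩ := hv
      refine (Set.toFinite {P, -P}).subset ?_
      rintro Q ⟨-, hQ⟩
      exact Affine.Point.eq_or_eq_neg_of_xRep_eq_xRep hQ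
    · refine Set.finite_empty.subset ?_
      rintro Q ⟨-, hQ⟩
      exact hv ⟨Q, hQ⟩

lemma Wc_fg {a b : ℚ} (h : 4 * a ^ 3 + 27 * b ^ 2 ≠ 0)
    (h2 : (nsmulAddMonoidHom (α := (Wcurve a b).Point) 2).range.FiniteIndex) :
    AddGroup.FG (Wcurve a b).Point := by
  obtain ⟨C, hC⟩ := nht_parallelogram h
  have := nht_northcott (a := a) (b := b)
  exact AddCommGroup.fg_of_descent' h2 (fun P => by unfold nht; positivity) hC

end Heights

open WeierstrassCurve

section DescentMap

/-- units modulo squares -/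
def SqCl (F : Type*) [Field F] : Type _ := Fˣ ⧸ (powMonoidHom 2 : Fˣ →* Fˣ).range

noncomputable instance (F : Type*) [Field F] : CommGroup (SqCl F) :=
  QuotientGroup.Quotient.commGroup _

/-- the class of a unit modulo squares -/
def sqMk {F : Type*} [Field F] : Fˣ →* SqCl F := QuotientGroup.mk' _

lemma sqMk_surjective {F : Type*} [Field F] : Function.Surjective (sqMk (F := F)) :=
  QuotientGroup.mk'_surjective _

lemma SqCl_mk_eq_one {F : Type*} [Field F] (u : Fˣ) :
    sqMk u = 1 ↔ ∃ z : F, (u : F) = z ^ 2 := by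
  have h0 : sqMk u = 1 ↔ u ∈ (powMonoidHom 2 : Fˣ →* Fˣ).range := QuotientGroup.eq_one_iff u
  rw [h0]
  constructor
  · rintro ⟨v, rfl⟩
    exact ⟨v, by simp⟩
  · rintro ⟨z, hz⟩
    have hz0 : z ≠ 0 := by
      rintro rfl
      exact u.ne_zero (by simp at hz)
    exact ⟨Units.mk0 z hz0, by ext; simp [hz]⟩

lemma SqCl_sq {F : Type*} [Field F] (q : SqCl F) : q * q = 1 := by
  obtain ⟨u, rfl⟩ := sqMk_surjective q
  rw [← map_mul, SqCl_mk_eq_one]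
  exact ⟨u, by simp [sq]⟩

/-- If `u v w` is a square then `[w] = [u] [v]`. -/
lemma SqCl_of_mul_sq {F : Type*} [Field F] (u v w : Fˣ) (z : F) (h : (u * v * w : F) = z ^ 2) :
    sqMk w = sqMk u * sqMk v := by
  have h1 : sqMk (u * v * w) = 1 :=
    (SqCl_mk_eq_one _).mpr ⟨z, by simpa using h⟩
  rw [map_mul, map_mul] at h1
  have h2 := SqCl_sq (sqMk w)
  exact (mul_right_cancel (h1.trans h2.symm)).symm

variable {F : Type*} [Field F] [CharZero F] {a b : ℚ} {e : F}

lemma line_vieta {l c x₁ x₂ : ℚ}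
    (E : (l * x₁ + c) ^ 2 = x₁ ^ 3 + a * x₁ + b)
    (D : l ^ 2 * (x₁ + x₂) + 2 * l * c = x₁ ^ 2 + x₁ * x₂ + x₂ ^ 2 + a)
    (he : e ^ 3 + a * e + b = 0) :
    ((x₁ : F) - e) * (x₂ - e) * (((l ^ 2 - x₁ - x₂ : ℚ) : F) - e) = (l * e + c) ^ 2 := by
  have E' : ((l : F) * x₁ + c) ^ 2 = x₁ ^ 3 + a * x₁ + b := by exact_mod_cast congrArg (Rat.cast (K := F)) E
  have D' : (l : F) ^ 2 * (x₁ + x₂) + 2 * l * c = x₁ ^ 2 + x₁ * x₂ + x₂ ^ 2 + a := by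
    exact_mod_cast congrArg (Rat.cast (K := F)) D
  push_cast
  linear_combination -E' + (x₁ - e) * D' - he

variable (e) in
/-- the map `P ↦ x(P) - e` -/
noncomputable def dmapFun (hne : ∀ x : ℚ, (x : F) - e ≠ 0) : (Wcurve a b).Point → SqCl F
  | .zero => 1
  | .some x _ _ => sqMk (Units.mk0 ((x : F) - e) (hne x))

lemma dmapFun_add (he : e ^ 3 + a * e + b = 0) (hne : ∀ x : ℚ, (x : F) - e ≠ 0)
    (P Q : (Wcurve a b).Point) : dmapFun e hne (P + Q) = dmapFun e hne P * dmapFun e hne Q := by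
  match P, Q with
  | 0, Q => rw [zero_add]; exact (one_mul (dmapFun e hne Q)).symm
  | P, 0 => rw [add_zero]; exact (mul_one (dmapFun e hne P)).symm
  | .some x₁ y₁ h₁, .some x₂ y₂ h₂ =>
    obtain ⟨he₁, -⟩ := Wc_nonsing h₁
    obtain ⟨he₂, -⟩ := Wc_nonsing h₂
    by_cases hxy : x₁ = x₂ ∧ y₁ = (Wcurve a b).negY x₂ y₂
    · rw [Affine.Point.add_of_Y_eq hxy.1 hxy.2]
      obtain ⟨rfl, -⟩ := hxy
      exact (SqCl_sq _).symm
    · rw [Affine.Point.add_some hxy]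
      refine SqCl_of_mul_sq _ _ _
        (((Wcurve a b).slope x₁ x₂ y₁ y₂ : F) * e
          + ((y₁ - (Wcurve a b).slope x₁ x₂ y₁ y₂ * x₁ : ℚ) : F)) ?_
      simp only [Units.val_mk0]
      rw [Wc_addX]
      apply line_vieta (a := a) (b := b) _ _ he
      · rw [← he₁]; ring
      · by_cases hx : x₁ = x₂
        · subst hx
          have hy : y₁ ≠ -y₂ := by
            rw [Wc_negY] at hxy; tauto
          have : (y₁ - y₂) * (y₁ + y₂) = 0 := by linear_combination he₁ - he₂
          rcases mul_eq_zero.mp this with h | h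
          · obtain rfl : y₁ = y₂ := by linarith
            have hy0 : y₁ ≠ 0 := by rintro rfl; simp at hy
            rw [Wc_slope_self _ _ hy0]
            field_simp
            ring
          · exact absurd (by linarith) hy
        · rw [Wc_slope_ne _ _ _ _ hx]
          have hx' := sub_ne_zero.mpr hx
          field_simp
          linear_combination (x₁ - x₂) * (he₁ - he₂)

variable (e) in
/-- The descent homomorphism. -/
noncomputable def dmap (he : e ^ 3 + a * e + b = 0) (hne : ∀ x : ℚ, (x : F) - e ≠ 0) :
    (Wcurve a b).Point →+ Additive (SqCl F) where
  toFun P := Additive.ofMul (dmapFun e hne P)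
  map_zero' := rfl
  map_add' P Q := congrArg Additive.ofMul (dmapFun_add he hne P Q)

lemma dmap_some (he : e ^ 3 + a * e + b = 0) (hne : ∀ x : ℚ, (x : F) - e ≠ 0) {x y : ℚ}
    (h : (Wcurve a b).Nonsingular x y) :
    dmap e he hne (.some x y h) =
      Additive.ofMul (sqMk (Units.mk0 ((x : F) - e) (hne x))) := rfl

end DescentMap

section SelmerFinite
open IsDedekindDomain

lemma ideal_sq_part {R : Type*} [CommRing R] [IsDedekindDomain R] (I : Ideal R) (hI : I ≠ 0) :
    ∃ J : Ideal R, J ≠ 0 ∧ I = J ^ 2 * ∏ᶠ v : HeightOneSpectrum R,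
      v.asIdeal ^ ((Associates.mk v.asIdeal).count (Associates.mk I).factors % 2) := by
  have key : ∀ g : ℕ → ℕ, g 0 = 0 → Function.HasFiniteMulSupport (fun v : HeightOneSpectrum R =>
      v.asIdeal ^ g ((Associates.mk v.asIdeal).count (Associates.mk I).factors)) := by
    intro g hg
    refine Set.Finite.subset (Filter.eventually_cofinite.mp (Associates.finite_factors hI)) ?_
    intro v hv h0
    apply hv
    have h1 : (Associates.mk v.asIdeal).count (Associates.mk I).factors = 0 := by exact_mod_cast h0
    simp [h1, hg]
  have h := Ideal.finprod_heightOneSpectrum_factorization hI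
  have h2 : I = (∏ᶠ v : HeightOneSpectrum R,
      v.asIdeal ^ ((Associates.mk v.asIdeal).count (Associates.mk I).factors / 2)) ^ 2 *
      ∏ᶠ v : HeightOneSpectrum R,
      v.asIdeal ^ ((Associates.mk v.asIdeal).count (Associates.mk I).factors % 2) := by
    rw [finprod_pow (key (fun n => n / 2) rfl), ← finprod_mul_distrib _ (key (fun n => n % 2) rfl)]
    · conv_lhs => rw [← h]
      refine finprod_congr fun v => ?_
      rw [HeightOneSpectrum.maxPowDividing, ← pow_mul, ← pow_add, Nat.div_add_mod']
    · simp_rw [← pow_mul]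
      exact key (fun n => n / 2 * 2) rfl
  refine ⟨_, ?_, h2⟩
  intro h0
  apply hI
  rw [h2, h0]
  simp

lemma exp_isSquare {n : ℕ} (h : IsSquare (WithZero.exp (-(n : ℤ)))) : n % 2 = 0 := by
  obtain ⟨g, hg⟩ := h
  have hg0 : g ≠ 0 := by
    rintro rfl
    simp at hg
  rw [← WithZero.exp_log hg0, ← WithZero.exp_add, WithZero.exp_inj] at hg
  omega

variable (K : Type*) [Field K] [NumberField K]
open NumberField

/-- the image of the units -/
noncomputable def unitCl : (𝓞 K)ˣ →* SqCl K :=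
  sqMk.comp (Units.map (algebraMap (𝓞 K) K : 𝓞 K →* K))

lemma unitCl_finite : Finite (unitCl K).range := by
  have : Group.FG (𝓞 K)ˣ := Group.fg_iff_monoid_fg.mpr inferInstance
  have : Group.FG (unitCl K).range := inferInstance
  apply CommGroup.finite_of_fg_isMulTorsion
  intro x
  rw [isOfFinOrder_iff_pow_eq_one]
  exact ⟨2, by norm_num, by
    ext
    rw [sq]
    exact SqCl_sq _⟩

/-- the Selmer set -/
def selSet (S : Set (HeightOneSpectrum (𝓞 K))) : Set (SqCl K) :=
  {q | ∃ u : Kˣ, sqMk u = q ∧ ∀ v ∉ S, IsSquare (v.valuation K (u : K))}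

variable {K}
lemma selSet_rep {S : Set (HeightOneSpectrum (𝓞 K))} {q : SqCl K} (hq : q ∈ selSet K S) :
    ∃ (r : 𝓞 K) (hr : algebraMap (𝓞 K) K r ≠ 0) (T : Set S) (J : nonZeroDivisors (Ideal (𝓞 K))),
      sqMk (Units.mk0 _ hr) = q ∧
      Ideal.span {r} = (J : Ideal (𝓞 K)) ^ 2 * ∏ᶠ v : HeightOneSpectrum (𝓞 K), by
        classical exact v.asIdeal ^ (if ∃ h : v ∈ S, (⟨v, h⟩ : S) ∈ T then 1 else 0) := by
  classical
  obtain ⟨u, rfl, hu⟩ := hq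
  obtain ⟨n, d, hd, hnd⟩ := IsFractionRing.div_surjective (A := 𝓞 K) (u : K)
  have hd0 : algebraMap (𝓞 K) K d ≠ 0 := by
    simpa using nonZeroDivisors.ne_zero hd
  have hn0 : algebraMap (𝓞 K) K n ≠ 0 := by
    intro h
    rw [h, zero_div] at hnd
    exact u.ne_zero hnd.symm
  have hr : algebraMap (𝓞 K) K (n * d) ≠ 0 := by
    rw [map_mul]; exact mul_ne_zero hn0 hd0
  have hrR : n * d ≠ 0 := by
    intro h; rw [h] at hr; simp at hr
  have hI : Ideal.span {n * d} ≠ (0 : Ideal (𝓞 K)) := by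
    simpa using hrR
  have hval : algebraMap (𝓞 K) K (n * d) = (u : K) * (algebraMap (𝓞 K) K d) ^ 2 := by
    rw [map_mul, ← hnd]; field_simp
  obtain ⟨J, hJ, hIJ⟩ := ideal_sq_part _ hI
  refine ⟨n * d, hr, {v | (Associates.mk v.1.asIdeal).count
    (Associates.mk (Ideal.span {n * d})).factors % 2 = 1}, ⟨J, mem_nonZeroDivisors_of_ne_zero hJ⟩, ?_, ?_⟩
  · have := SqCl_of_mul_sq 1 u (Units.mk0 _ hr) ((u : K) * (algebraMap (𝓞 K) K d)) (by
      simp only [Units.val_one, one_mul, Units.val_mk0, hval]; ring)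
    simpa using this
  · conv_lhs => rw [hIJ]
    congr 1
    refine finprod_congr fun v => ?_
    congr 1
    by_cases hv : v ∈ S
    · simp only [hv, exists_true_left, Set.mem_ofPred_eq]
      split_ifs <;> omega
    · simp only [hv, IsEmpty.exists_iff, if_false]
      apply exp_isSquare
      rw [← HeightOneSpectrum.intValuation_if_neg v hrR,
        ← HeightOneSpectrum.valuation_of_algebraMap (K := K)]
      change IsSquare (v.valuation K (algebraMap (𝓞 K) K (n * d)))
      rw [hval, map_mul, map_pow]
      exact (hu v hv).mul (IsSquare.sq _)

theorem selSet_finite {S : Set (HeightOneSpectrum (𝓞 K))} (hS : S.Finite) :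
    (selSet K S).Finite := by
  classical
  have := hS.to_subtype
  choose r hr T J h1 h2 using fun q : selSet K S => selSet_rep q.2
  let Φ : selSet K S → Set S × ClassGroup (𝓞 K) := fun q => (T q, ClassGroup.mk0 (J q))
  rw [← Set.finite_coe_iff, ← Set.finite_univ_iff]
  refine Set.Finite.of_finite_fibers Φ (Set.toFinite _) fun t ht => ?_
  rw [Set.univ_inter]
  obtain ⟨q0, -, rfl⟩ := ht
  have hU : ((unitCl K).range : Set (SqCl K)).Finite := by
    have := unitCl_finite K
    exact Set.toFinite _
  have h3 : ((fun x => x * q0.1) '' ((unitCl K).range : Set (SqCl K))).Finite := hU.image _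
  refine Set.Finite.of_finite_image (f := Subtype.val) (h3.subset ?_) Subtype.val_injective.injOn
  rintro _ ⟨q, hq, rfl⟩
  simp only [Set.mem_preimage, Set.mem_singleton_iff, Φ, Prod.mk.injEq] at hq
  obtain ⟨hT, hJ⟩ := hq
  obtain ⟨x, y, hx, hy, hxy⟩ := ClassGroup.mk0_eq_mk0_iff.mp hJ
  have e1 : Ideal.span {x ^ 2 * r q} = Ideal.span {y ^ 2 * r q0} := by
    rw [← Ideal.span_singleton_mul_span_singleton, ← Ideal.span_singleton_mul_span_singleton,
      ← Ideal.span_singleton_pow, ← Ideal.span_singleton_pow, h2 q, h2 q0, hT,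
      ← mul_assoc, ← mul_assoc, ← mul_pow, ← mul_pow, hxy]
  rw [Ideal.span_singleton_eq_span_singleton] at e1
  obtain ⟨ε, hε⟩ := e1
  refine ⟨unitCl K ε, ⟨ε, rfl⟩, ?_⟩
  simp only
  rw [← h1 q, ← h1 q0]
  have hε' := congrArg (algebraMap (𝓞 K) K) hε
  simp only [map_mul, map_pow] at hε'
  symm
  apply SqCl_of_mul_sq _ _ _
    ((algebraMap (𝓞 K) K ε) * algebraMap (𝓞 K) K (r q) * (algebraMap (𝓞 K) K x) / (algebraMap (𝓞 K) K y))
  have hy' : algebraMap (𝓞 K) K y ≠ 0 := by simpa using hy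
  simp only [Units.val_mk0, Units.coe_map, MonoidHom.coe_coe]
  rw [div_pow, eq_div_iff (pow_ne_zero 2 hy')]
  linear_combination (-(algebraMap (𝓞 K) K ε) * algebraMap (𝓞 K) K (r q)) * hε'

end SelmerFinite

open WeierstrassCurve

section WeakMW
open IsDedekindDomain NumberField

lemma val_even {K Γ : Type*} [Field K] [LinearOrderedCommGroupWithZero Γ] (w : Valuation K Γ)
    {t y θ D : K} (ht : t ≠ 0) (h3 : w (3 * θ) ≤ 1) (hD : w D = 1)
    (h : y ^ 2 = t * (t ^ 2 + 3 * θ * t + D)) : IsSquare (w t) := by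
  have hw := congrArg w h
  rw [map_pow, map_mul] at hw
  have ht0 : w t ≠ 0 := (Valuation.ne_zero_iff w).mpr ht
  have hpos : 0 < w t := zero_lt_iff.mpr ht0
  have h3t : w (3 * θ * t) ≤ w t := by
    rw [map_mul]
    exact mul_le_of_le_one_left' h3
  rcases lt_trichotomy (w t) 1 with h1 | h1 | h1
  · have hs : w (t ^ 2 + 3 * θ * t) < w D := by
      rw [hD]
      refine Valuation.map_add_lt w ?_ (h3t.trans_lt h1)
      rw [map_pow]
      exact pow_lt_one₀ zero_le h1 two_ne_zero
    rw [Valuation.map_add_eq_of_lt_right w hs, hD, mul_one] at hw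
    rw [← hw]
    exact IsSquare.sq _
  · rw [h1]
    exact IsSquare.one
  · have hlt : w t < w (t ^ 2) := by
      rw [map_pow, sq]
      exact lt_mul_of_one_lt_left hpos h1
    have hs : w (3 * θ * t + D) < w (t ^ 2) :=
      Valuation.map_add_lt w (h3t.trans_lt hlt) (by rw [hD]; exact h1.trans hlt)
    rw [add_assoc, Valuation.map_add_eq_of_lt_left w hs, map_pow] at hw
    refine ⟨w y / w t, ?_⟩
    rw [div_mul_div_comm, ← sq, hw, ← sq, mul_div_assoc, div_self (pow_ne_zero 2 ht0), mul_one]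

lemma double_of_line {a b x y c l m : ℚ} (h : (Wcurve a b).Nonsingular x y)
    (hroot : ∀ x : ℚ, x ^ 3 + a * x + b ≠ 0)
    (hx : x = m ^ 2 - 2 * c) (ha : a = c ^ 2 + 2 * x * c + 2 * l * m) (hb : b = l ^ 2 - x * c ^ 2) :
    ∃ Q : (Wcurve a b).Point, Q + Q = .some x y h := by
  obtain ⟨he, -⟩ := Wc_nonsing h
  have key : ∃ m' l' : ℚ, x = m' ^ 2 - 2 * c ∧ a = c ^ 2 + 2 * x * c + 2 * l' * m' ∧
      b = l' ^ 2 - x * c ^ 2 ∧ y = -(m' * x + l') := by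
    have : (y - (m * x + l)) * (y + (m * x + l)) = 0 := by
      linear_combination he + x * ha + hb + x ^ 2 * hx
    rcases mul_eq_zero.mp this with h | h
    · exact ⟨-m, -l, by linarith [neg_sq m], by linarith [neg_mul_neg l m], by linarith [neg_sq l],
        by linarith⟩
    · exact ⟨m, l, hx, ha, hb, by linarith⟩
  clear hx ha hb
  obtain ⟨m, l, hx, ha, hb, hy⟩ := key
  have hQe : (l + m * c) ^ 2 = c ^ 3 + a * c + b := by
    linear_combination (-c) * ha - hb - c ^ 2 * hx
  have hQ0 : l + m * c ≠ 0 := by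
    intro h0
    apply hroot c
    rw [← hQe, h0]
    ring
  have hQ : (Wcurve a b).Nonsingular c (l + m * c) := by
    rw [Affine.nonsingular_iff, Affine.equation_iff]
    simp only [Wcurve]
    refine ⟨by linarith, Or.inr ?_⟩
    intro h'
    apply hQ0
    linarith
  refine ⟨.some c (l + m * c) hQ, ?_⟩
  rw [Affine.Point.add_self_of_Y_ne (by rw [Wc_negY]; intro h'; apply hQ0; linarith)]
  have hs : (Wcurve a b).slope c c (l + m * c) (l + m * c) = m := by
    rw [Wc_slope_self _ _ hQ0, div_eq_iff (by positivity)]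
    linear_combination ha + 2 * c * hx
  have hX : (Wcurve a b).addX c c m = x := by rw [Wc_addX]; linarith
  simp only [Affine.Point.some.injEq, hs, hX]
  refine ⟨trivial, ?_⟩
  rw [Affine.addY, Affine.negAddY, hX, Wc_negY, hy]
  ring

variable {K : Type*} [Field K] [NumberField K] {a b : ℚ} {θ : K}

lemma double_of_sq (hθ : θ ^ 3 + a * θ + b = 0)
    (hspan : ∀ z : K, ∃ u0 u1 u2 : ℚ, z = u0 + u1 * θ + u2 * θ ^ 2)
    (hind : ∀ u0 u1 u2 : ℚ, (u0 : K) + u1 * θ + u2 * θ ^ 2 = 0 → u0 = 0 ∧ u1 = 0 ∧ u2 = 0)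
    (hroot : ∀ x : ℚ, x ^ 3 + a * x + b ≠ 0)
    {x y : ℚ} (h : (Wcurve a b).Nonsingular x y) (z : K) (hz : (x : K) - θ = z ^ 2) :
    ∃ Q : (Wcurve a b).Point, Q + Q = .some x y h := by
  obtain ⟨u0, u1, u2, rfl⟩ := hspan z
  by_cases hu : u2 = 0
  · subst hu
    obtain ⟨-, h1, h2⟩ := hind (x - u0 ^ 2) (-1 - 2 * u0 * u1) (- u1 ^ 2) (by
      push_cast at hz ⊢
      linear_combination hz)
    have : u1 = 0 := by simpa using h2
    subst this
    norm_num at h1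
  · have hc : u1 / u2 * u2 = u1 := by field_simp
    generalize u1 / u2 = c at hc
    subst hc
    obtain ⟨l, hl⟩ : ∃ l, l = c * u0 + u2 * b := ⟨_, rfl⟩
    obtain ⟨m, hm⟩ : ∃ m, m = c * (c * u2) - u0 + a * u2 := ⟨_, rfl⟩
    have hlm : ((c : K) - θ) * (u0 + ((c * u2 : ℚ) : K) * θ + u2 * θ ^ 2) = l + m * θ := by
      rw [hl, hm]; push_cast
      linear_combination (-u2 : K) * hθ
    obtain ⟨h0, h1, h2⟩ := hind (x * c ^ 2 - l ^ 2 + b) (- c ^ 2 - 2 * x * c - 2 * l * m + a)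
      (x + 2 * c - m ^ 2) (by
        push_cast
        have := congrArg (fun t => ((c : K) - θ) ^ 2 * t) hz
        simp only [← mul_pow, hlm] at this
        linear_combination this + hθ)
    exact double_of_line (c := c) (l := l) (m := m) h hroot (by linarith) (by linarith) (by linarith)

lemma finite_bad {d : 𝓞 K} (hd : d ≠ 0) :
    {v : HeightOneSpectrum (𝓞 K) | v.valuation K (algebraMap (𝓞 K) K d) ≠ 1}.Finite := by
  have hI : Ideal.span {d} ≠ (0 : Ideal (𝓞 K)) := by simpa using hd
  refine (Ideal.finite_factors hI).subset ?_
  intro v hv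
  have hle := HeightOneSpectrum.valuation_le_one (K := K) v d
  exact (HeightOneSpectrum.valuation_lt_one_iff_dvd v d).mp (lt_of_le_of_ne hle hv)

theorem weakMW (hθi : IsIntegral ℤ θ) (hai : IsIntegral ℤ (a : K)) (hθ : θ ^ 3 + a * θ + b = 0)
    (hspan : ∀ z : K, ∃ u0 u1 u2 : ℚ, z = u0 + u1 * θ + u2 * θ ^ 2)
    (hind : ∀ u0 u1 u2 : ℚ, (u0 : K) + u1 * θ + u2 * θ ^ 2 = 0 → u0 = 0 ∧ u1 = 0 ∧ u2 = 0)
    (hroot : ∀ x : ℚ, x ^ 3 + a * x + b ≠ 0) :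
    (nsmulAddMonoidHom (α := (Wcurve a b).Point) 2).range.FiniteIndex := by
  have hne : ∀ x : ℚ, (x : K) - θ ≠ 0 := by
    intro x hx
    have := (hind x (-1) 0 (by push_cast; linear_combination hx)).2.1
    norm_num at this
  obtain ⟨θ', hθ'⟩ : ∃ t : 𝓞 K, algebraMap (𝓞 K) K t = θ := ⟨⟨θ, hθi⟩, rfl⟩
  obtain ⟨a', ha'⟩ : ∃ t : 𝓞 K, algebraMap (𝓞 K) K t = (a : K) := ⟨⟨_, hai⟩, rfl⟩
  have hD : algebraMap (𝓞 K) K (3 * θ' ^ 2 + a') = 3 * θ ^ 2 + a := by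
    rw [map_add, map_mul, map_pow, hθ', ha', map_ofNat]
  have hd : 3 * θ' ^ 2 + a' ≠ 0 := by
    intro h0
    rw [h0, map_zero] at hD
    have := (hind a 0 3 (by push_cast; linear_combination -hD)).2.2
    norm_num at this
  have hfin := selSet_finite (finite_bad (K := K) hd)
  have hmem : ∀ P, (dmap θ hθ hne P).toMul ∈ selSet K
      {v : HeightOneSpectrum (𝓞 K) | v.valuation K (algebraMap (𝓞 K) K (3 * θ' ^ 2 + a')) ≠ 1} := by
    intro P
    match P with
    | 0 => exact ⟨1, by rw [map_zero, map_one]; rfl, fun v _ => by simp⟩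
    | .some x y h =>
      refine ⟨Units.mk0 ((x : K) - θ) (hne x), rfl, fun v hv => ?_⟩
      have hv1 : v.valuation K (algebraMap (𝓞 K) K (3 * θ' ^ 2 + a')) = 1 := by
        by_contra h'
        exact hv h'
      refine val_even (y := (y : K)) (θ := θ) _ (hne x) ?_ hv1 ?_
      · have : v.valuation K (algebraMap (𝓞 K) K (3 * θ')) ≤ 1 :=
          HeightOneSpectrum.valuation_le_one (K := K) v (3 * θ')
        rwa [map_mul (algebraMap (𝓞 K) K), hθ', map_ofNat] at this
      · obtain ⟨he, -⟩ := Wc_nonsing h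
        have he' : (y : K) ^ 2 = x ^ 3 + a * x + b := by
          exact_mod_cast congrArg (Rat.cast (K := K)) he
        rw [hD, Units.val_mk0]
        linear_combination he' + hθ
  have hker : (dmap θ hθ hne).ker ≤ (nsmulAddMonoidHom (α := (Wcurve a b).Point) 2).range := by
    intro P hP
    match P with
    | 0 => exact zero_mem _
    | .some x y h =>
      have h1 : sqMk (Units.mk0 ((x : K) - θ) (hne x)) = 1 := hP
      obtain ⟨z, hz⟩ := (SqCl_mk_eq_one _).mp h1
      obtain ⟨Q, hQ⟩ := double_of_sq hθ hspan hind hroot h z hz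
      exact ⟨Q, by simpa [two_nsmul] using hQ⟩
  have hrange : Finite (dmap θ hθ hne).range := by
    have : ((dmap θ hθ hne).range : Set (Additive (SqCl K))).Finite := by
      refine Set.Finite.subset (hfin.image Additive.ofMul) ?_
      rintro _ ⟨P, rfl⟩
      exact ⟨_, hmem P, rfl⟩
    exact this.to_subtype
  have hk : (dmap θ hθ hne).ker.FiniteIndex := by
    have e := QuotientAddGroup.quotientKerEquivRange (dmap θ hθ hne)
    have : Finite ((Wcurve a b).Point ⧸ (dmap θ hθ hne).ker) := Finite.of_equiv _ e.symm.toEquiv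
    exact AddSubgroup.finiteIndex_of_finite_quotient
  exact AddSubgroup.finiteIndex_of_le hker

end WeakMW

theorem Wc_module_finite (A B : ℤ) (hroot : ∀ x : ℚ, x ^ 3 + A * x + B ≠ 0)
    (hdisc : 4 * (A : ℚ) ^ 3 + 27 * (B : ℚ) ^ 2 ≠ 0) :
    Module.Finite ℤ (Wcurve A B).Point := by
  open Polynomial in
  let f : ℚ[X] := X ^ 3 + C (A : ℚ) * X + C (B : ℚ)
  have hdeg : f.natDegree = 3 := by
    simp only [f]; compute_degree!
  have hmonic : f.Monic := by
    simp only [f]; monicity!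
  have hf0 : f ≠ 0 := hmonic.ne_zero
  have hirr : Irreducible f := by
    rw [Polynomial.irreducible_iff_roots_eq_zero_of_degree_le_three (by omega) (by omega)]
    rw [Multiset.eq_zero_iff_forall_notMem]
    intro x hx
    rw [Polynomial.mem_roots hf0] at hx
    apply hroot x
    simpa [f, Polynomial.IsRoot] using hx
  have : Fact (Irreducible f) := ⟨hirr⟩
  let pb := AdjoinRoot.powerBasis hf0
  have hfd : FiniteDimensional ℚ (AdjoinRoot f) := pb.finite
  have hcz : CharZero (AdjoinRoot f) := algebraRat.charZero _
  have hnf : NumberField (AdjoinRoot f) := { to_charZero := hcz, to_finiteDimensional := by convert hfd }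
  have hθ : (AdjoinRoot.root f) ^ 3 + ((A : ℚ) : AdjoinRoot f) * AdjoinRoot.root f + ((B : ℚ) : AdjoinRoot f) = 0 := by
    have := AdjoinRoot.eval₂_root f
    simp only [f, Polynomial.eval₂_add, Polynomial.eval₂_mul, Polynomial.eval₂_pow,
      Polynomial.eval₂_X, Polynomial.eval₂_C, eq_ratCast] at this
    exact this
  have hmk : ∀ u0 u1 u2 : ℚ, AdjoinRoot.mk f (Polynomial.C u0 + Polynomial.C u1 * Polynomial.X
      + Polynomial.C u2 * Polynomial.X ^ 2) =
      (u0 : AdjoinRoot f) + u1 * AdjoinRoot.root f + u2 * AdjoinRoot.root f ^ 2 := by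
    intro u0 u1 u2
    simp only [map_add, map_mul, map_pow, AdjoinRoot.mk_X, AdjoinRoot.mk_C, eq_ratCast]
  have hspan : ∀ z : AdjoinRoot f, ∃ u0 u1 u2 : ℚ, z = (u0 : AdjoinRoot f) +
      u1 * AdjoinRoot.root f + u2 * AdjoinRoot.root f ^ 2 := by
    intro z
    obtain ⟨p, rfl⟩ := AdjoinRoot.mk_surjective z
    have h1 : AdjoinRoot.mk f p = AdjoinRoot.mk f (p %ₘ f) := by
      rw [AdjoinRoot.mk_eq_mk]
      exact ⟨p /ₘ f, by linear_combination -Polynomial.modByMonic_add_div p f⟩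
    have h2 : (p %ₘ f).natDegree < 3 := by
      rw [← hdeg]
      refine Polynomial.natDegree_modByMonic_lt p hmonic ?_
      intro h; rw [h] at hdeg; simp at hdeg
    refine ⟨(p %ₘ f).coeff 0, (p %ₘ f).coeff 1, (p %ₘ f).coeff 2, ?_⟩
    rw [h1, ← hmk]
    congr 1
    conv_lhs => rw [Polynomial.as_sum_range_C_mul_X_pow' _ h2]
    simp [Finset.sum_range_succ]
  have hind : ∀ u0 u1 u2 : ℚ, (u0 : AdjoinRoot f) + u1 * AdjoinRoot.root f
      + u2 * AdjoinRoot.root f ^ 2 = 0 → u0 = 0 ∧ u1 = 0 ∧ u2 = 0 := by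
    intro u0 u1 u2 h
    rw [← hmk, AdjoinRoot.mk_eq_zero] at h
    have h0 := Polynomial.eq_zero_of_dvd_of_natDegree_lt h (by
      rw [hdeg]
      refine lt_of_le_of_lt (b := 2) ?_ (by norm_num)
      compute_degree)
    refine ⟨?_, ?_, ?_⟩
    · simpa using congrArg (fun p => Polynomial.coeff p 0) h0
    · simpa [Polynomial.coeff_X, Polynomial.coeff_C] using congrArg (fun p => Polynomial.coeff p 1) h0
    · simpa [Polynomial.coeff_X, Polynomial.coeff_C] using congrArg (fun p => Polynomial.coeff p 2) h0
  have hAi : ∀ n : ℤ, IsIntegral ℤ ((n : ℚ) : AdjoinRoot f) := by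
    intro n
    have : ((n : ℚ) : AdjoinRoot f) = algebraMap ℤ (AdjoinRoot f) n := by simp
    rw [this]
    exact isIntegral_algebraMap
  have hθi : IsIntegral ℤ (AdjoinRoot.root f) := by
    refine ⟨Polynomial.X ^ 3 + Polynomial.C A * Polynomial.X + Polynomial.C B, by monicity!, ?_⟩
    simp only [Polynomial.eval₂_add, Polynomial.eval₂_mul, Polynomial.eval₂_pow,
      Polynomial.eval₂_X, Polynomial.eval₂_C]
    simpa using hθ
  have hW := weakMW (K := AdjoinRoot f) hθi (hAi A) hθ hspan hind hroot
  have hfg := Wc_fg hdisc hW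
  exact Module.Finite.iff_addGroup_fg.mpr hfg

open WeierstrassCurve

section Independence

lemma padic_root (p : ℕ) [Fact p.Prime] (A B r : ℤ) (h0 : (p : ℤ) ∣ r ^ 3 + A * r + B)
    (h1 : ¬ (p : ℤ) ∣ 3 * r ^ 2 + A) :
    ∃ e : ℤ_[p], e ^ 3 + A * e + B = 0 ∧ PadicInt.toZMod e = (r : ZMod p) := by
  let F : Polynomial ℤ := Polynomial.X ^ 3 + Polynomial.C A * Polynomial.X + Polynomial.C B
  have hF : ∀ z : ℤ_[p], F.aeval z = z ^ 3 + A * z + B := by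
    intro z; simp [F]
  have hF' : ∀ z : ℤ_[p], F.derivative.aeval z = 3 * z ^ 2 + A := by
    intro z
    simp only [F, Polynomial.derivative_add, Polynomial.derivative_X_pow,
      Polynomial.derivative_C_mul, Polynomial.derivative_X, Polynomial.derivative_C]
    simp only [map_add, map_mul, map_pow, Polynomial.aeval_C, Polynomial.aeval_X, map_natCast,
      map_one, map_zero]
    simp
  have n1 : ‖F.derivative.aeval (r : ℤ_[p])‖ = 1 := by
    rw [hF']
    have : (3 * (r : ℤ_[p]) ^ 2 + A) = ((3 * r ^ 2 + A : ℤ) : ℤ_[p]) := by push_cast; ring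
    rw [this]
    refine le_antisymm (PadicInt.norm_le_one _) (not_lt.mp ?_)
    rw [PadicInt.norm_int_lt_one_iff_dvd]
    exact h1
  have n0 : ‖F.aeval (r : ℤ_[p])‖ < 1 := by
    rw [hF]
    have : ((r : ℤ_[p]) ^ 3 + A * r + B) = ((r ^ 3 + A * r + B : ℤ) : ℤ_[p]) := by push_cast; ring
    rw [this, PadicInt.norm_int_lt_one_iff_dvd]
    exact h0
  obtain ⟨e, he, hd, -⟩ := hensels_lemma (F := F) (a := (r : ℤ_[p])) (by rw [n1]; simpa using n0)
  refine ⟨e, by rw [← hF]; exact he, ?_⟩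
  rw [n1] at hd
  have hmem : e - r ∈ RingHom.ker (PadicInt.toZMod (p := p)) := by
    rw [PadicInt.ker_toZMod]
    rw [IsLocalRing.mem_maximalIdeal, PadicInt.mem_nonunits]
    exact hd
  rw [RingHom.mem_ker, map_sub, map_intCast, sub_eq_zero] at hmem
  exact hmem

lemma unit_sq_pow (p : ℕ) [Fact p.Prime] (hp : p ≠ 2) (w : ℤ_[p]ˣ) (z : ℚ_[p])
    (hz : ((w : ℤ_[p]) : ℚ_[p]) = z ^ 2) :
    (Units.map (PadicInt.toZMod (p := p) : ℤ_[p] →* ZMod p) w) ^ (p / 2) = 1 := by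
  have hn : ‖z‖ = 1 := by
    have h1 : ‖((w : ℤ_[p]) : ℚ_[p])‖ = 1 := by
      rw [PadicInt.padic_norm_e_of_padicInt]
      exact PadicInt.norm_units w
    rw [hz, norm_pow] at h1
    exact (pow_eq_one_iff_of_nonneg (norm_nonneg _) two_ne_zero).mp h1
  let t : ℤ_[p] := ⟨z, hn.le⟩
  have ht : (w : ℤ_[p]) = t ^ 2 := by
    apply Subtype.ext
    rw [hz]
    rfl
  have hodd : 2 * (p / 2) = p - 1 := by
    have := (Fact.out : p.Prime).eq_two_or_odd
    omega
  have ht0 : PadicInt.toZMod t ≠ 0 := by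
    intro h0
    have h2 := (Units.map (PadicInt.toZMod (p := p) : ℤ_[p] →* ZMod p) w).ne_zero
    apply h2
    simp [ht, h0]
  ext
  simp only [Units.val_pow_eq_pow_val, Units.coe_map, MonoidHom.coe_coe, Units.val_one]
  rw [ht, map_pow, ← pow_mul, hodd]
  exact ZMod.pow_card_sub_one_eq_one ht0

lemma prod_zpow_sum {G ι : Type*} [CommGroup G] (g : G) (k : ι → ℤ) (s : Finset ι) :
    ∏ i ∈ s, g ^ k i = g ^ ∑ i ∈ s, k i := by
  classical
  induction s using Finset.induction_on with
  | empty => simp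
  | insert i s hi ih => rw [Finset.prod_insert hi, Finset.sum_insert hi, zpow_add, ih]

/-- the parity condition coming from one prime -/
theorem parity {ι : Type*} [Fintype ι] (p : ℕ) [Fact p.Prime] (hp : p ≠ 2) (A B r : ℤ)
    (hroot : ∀ x : ℚ, x ^ 3 + A * x + B ≠ 0)
    (h0 : (p : ℤ) ∣ r ^ 3 + A * r + B) (h1 : ¬ (p : ℤ) ∣ 3 * r ^ 2 + A)
    (X Y : ι → ℤ) (hP : ∀ i, (Wcurve A B).Nonsingular (X i : ℚ) (Y i : ℚ)) (m : ι → ℕ)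
    (hm : ∀ i, ((X i - r : ℤ) : ZMod p) ^ (p / 2) = (-1) ^ m i) (n : ι → ℤ)
    (hn : ∑ i, n i • (Affine.Point.some _ _ (hP i) : (Wcurve A B).Point) = 0) :
    Even (∑ i, n i * m i) := by
  obtain ⟨e, he, her⟩ := padic_root p A B r h0 h1
  have heq : (e : ℚ_[p]) ^ 3 + ((A : ℚ) : ℚ_[p]) * e + ((B : ℚ) : ℚ_[p]) = 0 := by
    have := congrArg (fun t : ℤ_[p] => (t : ℚ_[p])) he
    push_cast at this ⊢
    exact this
  have hne : ∀ x : ℚ, (x : ℚ_[p]) - e ≠ 0 := by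
    intro x hx
    apply hroot x
    rw [← sub_eq_zero.mp hx] at heq
    exact_mod_cast heq
  have hunit : ∀ i, IsUnit ((X i : ℤ_[p]) - e) := by
    intro i
    by_contra hu
    have h2 : (X i : ℤ_[p]) - e ∈ RingHom.ker (PadicInt.toZMod (p := p)) := by
      rw [PadicInt.ker_toZMod, IsLocalRing.mem_maximalIdeal]
      exact hu
    rw [RingHom.mem_ker, map_sub, map_intCast, her, ← Int.cast_sub] at h2
    have h3 := hm i
    have hp2 := (Fact.out : p.Prime).two_le
    rw [h2, zero_pow (by omega)] at h3
    exact pow_ne_zero (m i) (neg_ne_zero.mpr one_ne_zero) h3.symm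
  choose w hw using hunit
  have h4 := congrArg (dmap (e : ℚ_[p]) heq hne) hn
  rw [map_sum, map_zero] at h4
  simp only [map_zsmul, dmap_some] at h4
  have h5 : sqMk (∏ i, (Units.mk0 (((X i : ℚ) : ℚ_[p]) - e) (hne (X i))) ^ (n i)) = 1 := by
    rw [map_prod]
    simp only [map_zpow]
    exact h4
  have h6 : (∏ i, (Units.mk0 (((X i : ℚ) : ℚ_[p]) - e) (hne (X i))) ^ (n i)) =
      Units.map (PadicInt.Coe.ringHom (p := p) : ℤ_[p] →* ℚ_[p]) (∏ i, w i ^ n i) := by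
    rw [map_prod]
    refine Finset.prod_congr rfl fun i _ => ?_
    rw [map_zpow]
    congr 1
    ext
    simp only [Units.val_mk0, Units.coe_map, MonoidHom.coe_coe, hw, map_sub, map_intCast]
    push_cast
    rfl
  rw [h6] at h5
  obtain ⟨z, hz⟩ := (SqCl_mk_eq_one _).mp h5
  have h7 := unit_sq_pow p hp _ z hz
  rw [map_prod, ← Finset.prod_pow] at h7
  have h8 : ∀ i, (Units.map (PadicInt.toZMod (p := p) : ℤ_[p] →* ZMod p) (w i ^ n i)) ^ (p / 2) =
      (-1) ^ (n i * m i) := by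
    intro i
    have h9 : (Units.map (PadicInt.toZMod (p := p) : ℤ_[p] →* ZMod p) (w i)) ^ (p / 2) =
        (-1) ^ m i := by
      ext
      simp only [Units.val_pow_eq_pow_val, Units.coe_map, MonoidHom.coe_coe, hw, map_sub,
        map_intCast, her]
      rw [← Int.cast_sub, hm]
      simp
    rw [map_zpow, ← zpow_natCast, ← zpow_mul, mul_comm (n i), zpow_mul, zpow_natCast, h9,
      ← zpow_natCast, ← zpow_mul, mul_comm]
  rw [Finset.prod_congr rfl fun i _ => h8 i, prod_zpow_sum] at h7
  by_contra hodd
  rw [Int.not_even_iff_odd] at hodd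
  rw [hodd.neg_one_zpow] at h7
  have h10 := congrArg Units.val h7
  simp only [Units.val_neg, Units.val_one] at h10
  have : Fact (2 < p) := ⟨by have := (Fact.out : p.Prime).two_le; omega⟩
  exact ZMod.neg_one_ne_one h10

lemma no_two_torsion {a b : ℚ} (hroot : ∀ x : ℚ, x ^ 3 + a * x + b ≠ 0)
    (Q : (Wcurve a b).Point) (h : Q + Q = 0) : Q = 0 := by
  match Q with
  | 0 => rfl
  | .some x y hxy =>
    obtain ⟨he, -⟩ := Wc_nonsing hxy
    have h1 := eq_neg_of_add_eq_zero_left h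
    rw [Affine.Point.neg_some, Affine.Point.some.injEq, Wc_negY] at h1
    have hy : y = 0 := by linarith [h1.2]
    rw [hy] at he
    exact absurd (by linarith) (hroot x)

lemma indep_of_even {M ι : Type*} [AddCommGroup M] [Fintype ι] (P : ι → M)
    (h2 : ∀ Q : M, Q + Q = 0 → Q = 0)
    (hev : ∀ n : ι → ℤ, ∑ i, n i • P i = 0 → ∀ i, Even (n i)) : LinearIndependent ℤ P := by
  have key : ∀ t : ℕ, ∀ n : ι → ℤ, ∑ i, n i • P i = 0 → ∀ i, (2 : ℤ) ^ t ∣ n i := by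
    intro t
    induction t with
    | zero => intro n _ i; simp
    | succ t ih =>
      intro n hn
      choose k hk using hev n hn
      have h3 : ∑ i, k i • P i = 0 := by
        apply h2
        rw [← Finset.sum_add_distrib, ← hn]
        refine Finset.sum_congr rfl fun i _ => ?_
        rw [hk i, add_smul]
      intro i
      obtain ⟨c, hc⟩ := ih k h3 i
      exact ⟨c, by rw [hk i, hc]; ring⟩
  rw [Fintype.linearIndependent_iff]
  intro n hn i
  apply Int.eq_zero_of_abs_lt_dvd (key (n i).natAbs n hn i)
  have := Nat.lt_two_pow_self (n := (n i).natAbs)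
  rw [Int.abs_eq_natAbs]
  exact_mod_cast this

end Independence

open WeierstrassCurve

section Data

/-- coefficient of the curve of Elkies -/
def eA : ℤ := -321084198649208425360531331349416684014883684994863304027

/-- coefficient of the curve of Elkies -/
def eB : ℤ := 2206823154881955613890111083863921905341572013635896211771607846947800439724000275446

/-- the coordinates of the 28 points -/
def ePts : List (ℤ × ℤ) := [
  (-8496600365017524293168549853, 2078835936415188295643759071041951862742400),
  (9338039464138807027539018147, 150976033563965091486410671229456562470400),
  (-6686944216249476255516154653, 2013675018089147615523839328454297492238400),
  (8556521040556626665971928547, 293116073371526390140412234170196352148800),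
  (6138827057868482895541909347, 683436682768147693139226131385144124305600),
  (-10924317951502708133366300253, 2100174523874646608812321078283083780800000),
  (11102905067378286598821834147, 102766043792123584896023279879259944793600),
  (5977542917308755830167335267, 707892844221873225431849264868224034626880),
  (7473752914483549434036261027, 473899225715509143454715606693908904974080),
  (8035780435302975099466170147, 381525423041012458837649309227430863862400),
  (9393442163672100678606531747, 139943440049613856300886331912269041440000),
  (-5888336028361924697880034653, 1973147605228023825263551170473380507718400),
  (11696514430832244853453155747, 226802115451922724526337684042992460352000),
  (21499975564264247573175738147, 2289511267418128591584964519579412325590400),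
  (6838763072933418093336034227, 575190679797495554492350537651821183407280),
  (9803816045414372576290380747, 35561825388270878672439514777462008273000),
  (11877018837094236669858699747, 262135144602942043429506554581953616200000),
  (10847659739766770405331531747, 16547492902237901248943078622458056440000),
  (80314344311987418115113315747, 22236868329102533151592725792415107354048000),
  (8632329800962939097271242787, 279954987215720846809558260873504481280640),
  (8018581832988236089612899747, 384394638245645182761351924235197416640000),
  (11902997803791985059788365347, 267191918608614481559475267265898651318400),
  (-8409961870745140600589391453, 2076611131678997906611548400232897036428800),
  (1246332719660252139608778147, 1344835081839846074653595443577420836569600),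
  (11095724033367460925775087267, 101057302677210463743346297651079981594880),
  (8626324752575073637453845547, 281000743712191897500785779204638878544200),
  (15465321999489650035262636547, 969582045247569275666294903370242041216800),
  (8923473159094304095114714947, 228470080244788808780255259110244234943200)]

/-- the auxiliary primes `p`, a root mod `p`, and the row of residue symbols -/
def ePr : List (ℕ × ℕ × ℕ) := [
  (41, 0, 93236278),
  (41, 14, 94108775),
  (43, 7, 164387395),
  (59, 30, 172827567),
  (59, 40, 214454481),
  (67, 32, 42262721),
  (83, 37, 96514246),
  (101, 87, 163709569),
  (103, 39, 238074569),
  (107, 101, 134447289),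
  (131, 17, 252843487),
  (131, 28, 251056290),
  (137, 48, 79886108),
  (137, 68, 121858091),
  (139, 39, 256671745),
  (157, 10, 27066118),
  (163, 120, 178591974),
  (173, 67, 172481311),
  (181, 138, 135659577),
  (193, 80, 97613346),
  (197, 166, 100526462),
  (211, 51, 131162161),
  (211, 172, 14244916),
  (227, 40, 134332701),
  (229, 136, 23415854),
  (239, 147, 128774706),
  (251, 34, 99652978),
  (251, 94, 207573835)]

/-- the inverse matrix mod 2, rows encoded in binary -/
def eInv : List ℕ := [
  204263859,
  205758434,
  241312994,
  212803655,
  255853505,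
  256693043,
  226903581,
  57254347,
  29667043,
  166080037,
  147714449,
  221205866,
  230104364,
  208949042,
  204103180,
  203060359,
  266430019,
  254387445,
  27603508,
  9631803,
  20153147,
  222938848,
  145285192,
  213511872,
  45072476,
  60526344,
  128562395,
  255079676]

/-- X coordinate -/
def eX (i : Fin 28) : ℤ := (ePts.getD i.val (0, 0)).1

/-- Y coordinate -/
def eY (i : Fin 28) : ℤ := (ePts.getD i.val (0, 0)).2

/-- prime -/
def eP (k : Fin 28) : ℕ := (ePr.getD k.val (0, 0, 0)).1

/-- root -/
def eR (k : Fin 28) : ℕ := (ePr.getD k.val (0, 0, 0)).2.1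

/-- matrix of residue symbols -/
def eM (k i : Fin 28) : ℕ := (ePr.getD k.val (0, 0, 0)).2.2 / 2 ^ i.val % 2

/-- inverse matrix -/
def eN (j k : Fin 28) : ℕ := eInv.getD j.val 0 / 2 ^ k.val % 2

lemma ePts_eq : ∀ i : Fin 28, eY i * eY i = eX i * eX i * eX i + eA * eX i + eB ∧ eY i ≠ 0 := by
  decide +kernel

lemma eP_prime : ∀ k : Fin 28, (eP k).Prime := by
  intro k
  fin_cases k <;> norm_num [eP, ePr]

lemma eP_ne_two : ∀ k : Fin 28, eP k ≠ 2 := by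
  decide +kernel

lemma eR_root : ∀ k : Fin 28, ((eR k : ℤ) * eR k * eR k + eA * eR k + eB) % (eP k : ℤ) = 0 ∧
    (3 * ((eR k : ℤ) * eR k) + eA) % (eP k : ℤ) ≠ 0 := by
  decide +kernel

lemma eM_symbol : ∀ k i : Fin 28, (((eX i - eR k) % (eP k : ℤ)).toNat) ^ (eP k / 2) % eP k =
    if eM k i = 0 then 1 else eP k - 1 := by
  decide +kernel

lemma eN_inv : ∀ j i : Fin 28, (∑ k, eN j k * eM k i) % 2 = if i = j then 1 else 0 := by
  decide +kernel

end Data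

open WeierstrassCurve

section Final

lemma e_noroot (x : ℚ) : x ^ 3 + eA * x + eB ≠ 0 := by
  intro hx
  have hxint : IsIntegral ℤ x := by
    refine ⟨Polynomial.X ^ 3 + Polynomial.C eA * Polynomial.X + Polynomial.C eB, by monicity!, ?_⟩
    simp only [Polynomial.eval₂_add, Polynomial.eval₂_mul, Polynomial.eval₂_pow,
      Polynomial.eval₂_X, Polynomial.eval₂_C]
    simpa using hx
  obtain ⟨t, rfl⟩ := IsIntegrallyClosed.isIntegral_iff.mp hxint
  have h1 : t ^ 3 + eA * t + eB = 0 := by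
    simp only [eq_intCast] at hx
    exact_mod_cast hx
  have h2 := congrArg (Int.cast : ℤ → ZMod 23) h1
  push_cast at h2
  have h3 : ∀ s : ZMod 23, s ^ 3 + (eA : ZMod 23) * s + (eB : ZMod 23) ≠ 0 := by
    have ha : (eA : ZMod 23) = ((eA % 23 : ℤ) : ZMod 23) := (ZMod.intCast_mod eA 23).symm
    have hb : (eB : ZMod 23) = ((eB % 23 : ℤ) : ZMod 23) := (ZMod.intCast_mod eB 23).symm
    rw [ha, hb]
    decide +kernel
  exact h3 _ h2

lemma e_nonsing (i : Fin 28) : (Wcurve eA eB).Nonsingular (eX i : ℚ) (eY i : ℚ) := by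
  obtain ⟨h1, h2⟩ := ePts_eq i
  have h1' : (eY i : ℚ) * eY i = eX i * eX i * eX i + eA * eX i + eB := by exact_mod_cast h1
  have h2' : (eY i : ℚ) ≠ 0 := by exact_mod_cast h2
  rw [Affine.nonsingular_iff, Affine.equation_iff]
  simp only [Wcurve]
  refine ⟨by linarith, Or.inr ?_⟩
  intro h'
  apply h2'
  linarith

/-- the points -/
noncomputable def ePoint (i : Fin 28) : (Wcurve eA eB).Point := .some _ _ (e_nonsing i)

lemma even_of_inv {ι : Type*} [Fintype ι] [DecidableEq ι] (M N : ι → ι → ℕ) (n : ι → ℤ)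
    (hk : ∀ k, Even (∑ i, n i * (M k i : ℤ)))
    (hinv : ∀ j i, (∑ k, N j k * M k i) % 2 = if i = j then 1 else 0) (j : ι) : Even (n j) := by
  have hs : Even (∑ k, (N j k : ℤ) * ∑ i, n i * (M k i : ℤ)) :=
    Finset.even_sum _ fun k _ => (hk k).mul_left _
  have hs2 : ∑ k, (N j k : ℤ) * ∑ i, n i * (M k i : ℤ) =
      ∑ i, n i * ((∑ k, N j k * M k i : ℕ) : ℤ) := by
    simp_rw [Nat.cast_sum, Finset.mul_sum]
    rw [Finset.sum_comm]
    refine Finset.sum_congr rfl fun i _ => Finset.sum_congr rfl fun k _ => ?_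
    push_cast
    ring
  rw [hs2] at hs
  have hd : Even (∑ i, n i * ((∑ k, N j k * M k i : ℕ) : ℤ) -
      ∑ i, n i * (if i = j then 1 else 0)) := by
    rw [← Finset.sum_sub_distrib]
    refine Finset.even_sum _ fun i _ => ?_
    rw [← mul_sub]
    apply Even.mul_left
    have h7 := hinv j i
    generalize ∑ k, N j k * M k i = T at h7
    rw [Int.even_iff]
    split_ifs at h7 ⊢ <;> omega
  have he := hs.sub hd
  simpa using he

lemma symbol_aux (p : ℕ) (hp : 2 ≤ p) (z : ℤ) (m : ℕ) (h4 : m < 2)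
    (h2 : ((z % (p : ℤ)).toNat) ^ (p / 2) % p = if m = 0 then 1 else p - 1) :
    (z : ZMod p) ^ (p / 2) = (-1) ^ m := by
  have hpos : 0 ≤ z % (p : ℤ) := Int.emod_nonneg _ (by omega)
  have h3 : (z : ZMod p) = (((z % (p : ℤ)).toNat : ℕ) : ZMod p) := by
    have h5 : (((z % (p : ℤ)).toNat : ℤ) : ZMod p) = (z : ZMod p) := by
      rw [Int.toNat_of_nonneg hpos, ZMod.intCast_mod]
    rw [← h5, Int.cast_natCast]
  rw [h3, ← Nat.cast_pow, ← ZMod.natCast_mod, h2]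
  split_ifs with h5
  · rw [h5]; simp
  · have h6 : m = 1 := by omega
    rw [h6, Nat.cast_sub (by omega)]
    simp

lemma e_parity (n : Fin 28 → ℤ) (hn : ∑ i, n i • ePoint i = 0) (k : Fin 28) :
    Even (∑ i, n i * (eM k i : ℤ)) := by
  have : Fact (eP k).Prime := ⟨eP_prime k⟩
  obtain ⟨h0, h1⟩ := eR_root k
  have h0' : (eP k : ℤ) ∣ (eR k : ℤ) ^ 3 + eA * eR k + eB := by
    refine Int.dvd_of_emod_eq_zero (Eq.trans ?_ h0)
    congr 1
    ring
  have h1' : ¬ (eP k : ℤ) ∣ 3 * (eR k : ℤ) ^ 2 + eA := by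
    intro h
    apply h1
    rw [← sq]
    exact Int.emod_eq_zero_of_dvd h
  have h2 : ∀ i, ((eX i - eR k : ℤ) : ZMod (eP k)) ^ (eP k / 2) = (-1) ^ eM k i := fun i =>
    symbol_aux (eP k) (eP_prime k).two_le _ _ (Nat.mod_lt _ (by norm_num)) (eM_symbol k i)
  exact parity (eP k) (eP_ne_two k) eA eB (eR k) e_noroot h0' h1' eX eY e_nonsing (eM k) h2 n hn

lemma e_even (n : Fin 28 → ℤ) (hn : ∑ i, n i • ePoint i = 0) (j : Fin 28) : Even (n j) :=
  even_of_inv eM eN n (e_parity n hn) eN_inv j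

end Final

/-- Elkies: there is an elliptic curve over `ℚ` whose Mordell–Weil group has
rank `> 27`, i.e. rank at least `28`. -/
theorem exists_elliptic_curve_rank_gt_27 :
    ∃ A₄ A₆ : ℚ, 4 * A₄ ^ 3 + 27 * A₆ ^ 2 ≠ 0 ∧
      27 < Module.finrank ℤ (Wcurve A₄ A₆).Point := by
  have hdisc : 4 * (eA : ℚ) ^ 3 + 27 * (eB : ℚ) ^ 2 ≠ 0 := by
    have h : 4 * eA ^ 3 + 27 * eB ^ 2 ≠ 0 := by
      norm_num [eA, eB]
    exact_mod_cast h
  refine ⟨eA, eB, hdisc, ?_⟩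
  have := Wc_module_finite eA eB e_noroot hdisc
  have hli := indep_of_even ePoint (no_two_torsion e_noroot) e_even
  have := hli.fintype_card_le_finrank
  rw [Fintype.card_fin] at this
  omega
end
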